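/- arXiv:1811.08059 — 12 statements merged into one kernel-verified Lean document; each statement's English description precedes it below -/
import Mathlib

section
/- Let N ≥ 1, let A^{(n,ν)}_{n−k} (1 ≤ k ≤ n ≤ N) be real discrete convolution kernels satisfying assumption A1, and let ν ∈ [0,1/2). Then for every real sequence (v^k)_{k=0}^N and every 1 ≤ n ≤ N one has v^{n−ν} · Σ_{k=1}^n A^{(n,ν)}_{n−k} (v^k − v^{k−1}) ≥ (1/2) Σ_{k=1}^n A^{(n,ν)}_{n−k} ((v^k)² − (v^{k−1})²). -/
/-- For kernels satisfying assumption A1 and ν ∈ [0,1/2), the discrete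
Caputo-type quadratic inequality
`v^{n−ν} · Σ_{k=1}^n A^{(n,ν)}_{n−k} ∇v^k ≥ (1/2) Σ_{k=1}^n A^{(n,ν)}_{n−k} ∇((v^k)²)` holds. -/
theorem stmt_0 (N : ℕ) (hN : 1 ≤ N) (ν : ℝ) (hν0 : 0 ≤ ν) (hν1 : ν < 1/2)
    (A : ℕ → ℕ → ℝ)
    (hA1mono : ∀ n k : ℕ, 2 ≤ k → k ≤ n → n ≤ N → A n (k-1) ≤ A n (k-2) ∧ 0 < A n (k-1))
    (hA1first : ∀ n : ℕ, 2 ≤ n → n ≤ N → 0 ≤ (1 - 2*ν) * A n 0 - (1-ν) * A n 1)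
    (hA1pos : ∀ n : ℕ, 1 ≤ n → n ≤ N → 0 < A n 0)
    (v : ℕ → ℝ) (n : ℕ) (hn1 : 1 ≤ n) (hnN : n ≤ N) :
    (1/2) * ∑ k ∈ Finset.Icc 1 n, A n (n-k) * ((v k)^2 - (v (k-1))^2)
      ≤ (ν * v (n-1) + (1-ν) * v n) *
          ∑ k ∈ Finset.Icc 1 n, A n (n-k) * (v k - v (k-1)) := by
  set w := ν * v (n-1) + (1-ν) * v n with hw
  have hsum : (1/2) * ∑ k ∈ Finset.Icc 1 n, A n (n-k) * ((v k)^2 - (v (k-1))^2)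
      - w * ∑ k ∈ Finset.Icc 1 n, A n (n-k) * (v k - v (k-1))
      = (1/2) * ∑ k ∈ Finset.Icc 1 n, A n (n-k) * ((v k - w)^2 - (v (k-1) - w)^2) := by
    rw [Finset.mul_sum, Finset.mul_sum, Finset.mul_sum, ← Finset.sum_sub_distrib]
    exact Finset.sum_congr rfl fun k _ => by ring
  have key : ∀ m : ℕ, m + 1 ≤ n →
      ∑ k ∈ Finset.Icc 1 (m+1), A n (n-k) * ((v k - w)^2 - (v (k-1) - w)^2)
        ≤ A n (n-(m+1)) * (v (m+1) - w)^2 := by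
    intro m
    induction m with
    | zero =>
      intro h
      have hp : 0 < A n (n-1) := by
        rcases Nat.lt_or_ge n 2 with h2 | h2
        · have h1 : n = 1 := by omega
          have h3 := hA1pos n hn1 hnN
          simpa [h1] using h3
        · exact (hA1mono n n h2 le_rfl hnN).2
      simp only [Nat.zero_add, Finset.Icc_self, Finset.sum_singleton]
      nlinarith [mul_nonneg hp.le (sq_nonneg (v (1-1) - w))]
    | succ m ih =>
      intro h
      have h1 := ih (by omega)
      have h2 := (hA1mono n (n-m) (by omega) (by omega) hnN).1
      rw [show n - m - 1 = n - (m+1) by omega, show n - m - 2 = n - (m+1+1) by omega] at h2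
      rw [Finset.sum_Icc_succ_top (by omega), Nat.add_sub_cancel]
      nlinarith [mul_le_mul_of_nonneg_right h2 (sq_nonneg (v (m+1) - w))]
  have fin : ∑ k ∈ Finset.Icc 1 n, A n (n-k) * ((v k - w)^2 - (v (k-1) - w)^2) ≤ 0 := by
    have e1 : v n - w = ν * (v n - v (n-1)) := by rw [hw]; ring
    have e2 : v (n-1) - w = -((1-ν) * (v n - v (n-1))) := by rw [hw]; ring
    have hp := hA1pos n hn1 hnN
    obtain ⟨m, rfl⟩ : ∃ m, n = m + 1 := ⟨n-1, by omega⟩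
    have hd := sq_nonneg (v (m+1) - v (m+1-1))
    rw [Finset.sum_Icc_succ_top (by omega), e1, e2, Nat.sub_self]
    generalize v (m+1) - v (m+1-1) = d at *
    rcases m with _ | m
    · have : 0 ≤ (A (0+1) 0 * (1 - 2*ν)) * d^2 :=
        mul_nonneg (mul_nonneg hp.le (by linarith)) hd
      simp only [Nat.zero_add, Finset.Icc_eq_empty (show ¬ (1:ℕ) ≤ 0 by omega),
        Finset.sum_empty] at *
      linarith
    · have h1 := key m (by omega)
      rw [show m + 1 + 1 - (m+1) = 1 by omega] at h1
      rw [show m + 1 + 1 - 1 = m + 1 by omega] at e2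
      rw [e2] at h1
      have hf := hA1first (m+1+1) (by omega) hnN
      have h3 : 0 ≤ (1-ν) * ((1 - 2*ν) * A (m+1+1) 0 - (1-ν) * A (m+1+1) 1) * d^2 :=
        mul_nonneg (mul_nonneg (by linarith) hf) hd
      have h4 : 0 ≤ ν * ((1 - 2*ν) * A (m+1+1) 0) * d^2 :=
        mul_nonneg (mul_nonneg hν0 (mul_nonneg (by linarith) hp.le)) hd
      linarith
  linarith
end

section
/- Let N ≥ 1, ν ∈ [0,1/2), and let A^{(n,ν)}_{n−k} (1 ≤ k ≤ n ≤ N) be discrete convolution kernels satisfying assumption A1. Define the complementary discrete convolution kernels P^{(n,ν)}_{n−j} by the recursion P^{(n,ν)}_0 := 1/A^{(n,ν)}_0 and P^{(n,ν)}_{n−j} := (1/A^{(j,ν)}_0) Σ_{k=j+1}^{n} (A^{(k,ν)}_{k−j−1} − A^{(k,ν)}_{k−j}) P^{(n,ν)}_{n−k} for 1 ≤ j ≤ n−1. Then P^{(n,ν)}_{n−j} ≥ 0 for all 1 ≤ j ≤ n ≤ N, and Σ_{j=k}^{n} P^{(n,ν)}_{n−j} A^{(j,ν)}_{j−k} = 1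 for all 1 ≤ k ≤ n ≤ N. -/
/-- Under assumption A1, the complementary discrete convolution kernels
`P^{(n,ν)}_{n−j}` defined by the stated recursion are nonnegative and satisfy the
orthogonality identity `Σ_{j=k}^n P^{(n,ν)}_{n−j} A^{(j,ν)}_{j−k} = 1`. -/
theorem stmt_1 (N : ℕ) (hN : 1 ≤ N) (ν : ℝ) (hν0 : 0 ≤ ν) (hν1 : ν < 1/2)
    (A P : ℕ → ℕ → ℝ)
    (hA1mono : ∀ n k : ℕ, 2 ≤ k → k ≤ n → n ≤ N → A n (k-1) ≤ A n (k-2) ∧ 0 < A n (k-1))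
    (hA1first : ∀ n : ℕ, 2 ≤ n → n ≤ N → 0 ≤ (1 - 2*ν) * A n 0 - (1-ν) * A n 1)
    (hA1pos : ∀ n : ℕ, 1 ≤ n → n ≤ N → 0 < A n 0)
    (hP0 : ∀ n : ℕ, 1 ≤ n → n ≤ N → P n 0 = 1 / A n 0)
    (hPrec : ∀ n j : ℕ, 1 ≤ j → j + 1 ≤ n → n ≤ N →
      P n (n-j) = (1 / A j 0) *
        ∑ k ∈ Finset.Icc (j+1) n, (A k (k-j-1) - A k (k-j)) * P n (n-k)) :
    (∀ n j : ℕ, 1 ≤ j → j ≤ n → n ≤ N → 0 ≤ P n (n-j)) ∧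
    (∀ n k : ℕ, 1 ≤ k → k ≤ n → n ≤ N →
      ∑ j ∈ Finset.Icc k n, P n (n-j) * A j (j-k) = 1) := by
  constructor
  · intro n j hj hjn hnN
    obtain ⟨d, hd⟩ : ∃ d, d = n - j := ⟨_, rfl⟩
    induction d using Nat.strong_induction_on generalizing j with
    | _ d ih =>
      rcases Nat.lt_or_ge j n with h | h
      · rw [hPrec n j hj h hnN]
        have hpos := hA1pos j hj (by omega)
        refine mul_nonneg (by positivity) (Finset.sum_nonneg ?_)
        intro k hk
        rw [Finset.mem_Icc] at hk
        have h1 := (hA1mono k (k-j+1) (by omega) (by omega) (by omega)).1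
        have e1 : k - j + 1 - 1 = k - j := by omega
        have e2 : k - j + 1 - 2 = k - j - 1 := by omega
        rw [e1, e2] at h1
        exact mul_nonneg (by linarith) (ih (n-k) (by omega) k (by omega) hk.2 rfl)
      · have e : n - j = 0 := by omega
        rw [e, hP0 n (by omega) hnN]
        have hpos := hA1pos n (by omega) hnN
        positivity
  · intro n k hk hkn hnN
    induction hkn using Nat.decreasingInduction with
    | self =>
      have hpos := hA1pos n hk hnN
      simp only [Finset.Icc_self, Finset.sum_singleton, Nat.sub_self]
      rw [hP0 n hk hnN]
      field_simp
    | of_succ k hkn ih =>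
      have hpos := hA1pos k hk (by omega)
      have ih := ih (by omega)
      rw [← Finset.add_sum_Ioc_eq_sum_Icc (by omega : k ≤ n), hPrec n k hk hkn hnN, Nat.sub_self]
      have e : Finset.Ioc k n = Finset.Icc (k+1) n := by
        ext x
        simp only [Finset.mem_Ioc, Finset.mem_Icc]
        omega
      rw [e]
      have h3 : ∀ S : ℝ, 1 / A k 0 * S * A k 0 = S := by
        intro S
        field_simp
      rw [h3, ← Finset.sum_add_distrib]
      refine Eq.trans ?_ ih
      refine Finset.sum_congr rfl fun j _ => ?_
      rw [Nat.sub_sub j k 1]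
      ring
end

section
/- Let 0 < α < 1, let 0 = t_0 < t_1 < ⋯ < t_N = T be a mesh with steps τ_k := t_k − t_{k−1}, and let A^{(n,ν)}_{n−k} be discrete convolution kernels satisfying assumptions A1 and A2 with constant π_A > 0. Then the complementary kernels P^{(n,ν)}_{n−j} satisfy, for m = 0 and m = 1, Σ_{j=1}^{n} P^{(n,ν)}_{n−j} ω_{1+mα−α}(t_j) ≤ π_A ω_{1+mα}(t_n) for all 1 ≤ n ≤ N. -/
theorem aux_sum (f : ℕ → ℝ) (n : ℕ) :
    ∑ k ∈ Finset.Icc 1 n, f k = ∑ k ∈ Finset.range n, f (k + 1) := by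
  induction n with
  | zero => simp
  | succ n ih => rw [Finset.sum_Icc_succ_top (by omega), ih, Finset.sum_range_succ]

open MeasureTheory in
theorem aux_beta (α a : ℝ) (hα0 : 0 < α) (hα1 : α < 1) (ha : 0 < a) :
    ∫ x in (0:ℝ)..a, (a - x) ^ (-α) * x ^ (α - 1) = Real.Gamma α * Real.Gamma (1 - α) := by
  have h1 := Complex.betaIntegral_scaled (α : ℂ) ((1 - α : ℝ) : ℂ) ha
  have h2 := Complex.Gamma_mul_Gamma_eq_betaIntegral (s := (α : ℂ)) (t := ((1 - α : ℝ) : ℂ))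
    (by simpa using hα0) (by simpa using hα1)
  have e : (α : ℂ) + ((1 - α : ℝ) : ℂ) = 1 := by push_cast; ring
  rw [e] at h1 h2
  rw [sub_self, Complex.cpow_zero, one_mul] at h1
  rw [Complex.Gamma_one, one_mul] at h2
  rw [← h2, Complex.Gamma_ofReal, Complex.Gamma_ofReal] at h1
  apply Complex.ofReal_injective
  rw [← intervalIntegral.integral_ofReal, Complex.ofReal_mul, ← h1]
  apply intervalIntegral.integral_congr
  intro x hx
  rw [Set.uIcc_of_le ha.le] at hx
  have e1 : ((1 - α : ℝ) : ℂ) - 1 = ((-α : ℝ) : ℂ) := by push_cast; ring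
  have e2 : (α : ℂ) - 1 = ((α - 1 : ℝ) : ℂ) := by push_cast; ring
  simp only
  rw [e1, e2, ← Complex.ofReal_sub a x, ← Complex.ofReal_cpow hx.1,
    ← Complex.ofReal_cpow (sub_nonneg.2 hx.2), ← Complex.ofReal_mul, mul_comm]

open MeasureTheory in
theorem aux_int (α a : ℝ) (hα0 : 0 < α) (hα1 : α < 1) (ha : 0 < a) :
    IntervalIntegrable (fun x : ℝ => (a - x) ^ (-α) * x ^ (α - 1)) volume 0 a := by
  apply intervalIntegral.intervalIntegrable_of_integral_ne_zero
  rw [aux_beta α a hα0 hα1 ha]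
  have := Real.Gamma_pos_of_pos hα0
  have := Real.Gamma_pos_of_pos (sub_pos.2 hα1)
  positivity

open MeasureTheory in
theorem aux_int2 (α r a b : ℝ) (hα1 : α < 1) :
    IntervalIntegrable (fun x : ℝ => (r - x) ^ (-α)) volume a b := by
  have h := (intervalIntegral.intervalIntegrable_rpow' (r := -α) (a := r - a) (b := r - b)
    (by linarith)).comp_sub_left r
  simpa using h

open MeasureTheory in
theorem aux_cheb (α r a b : ℝ) (hα0 : 0 < α) (hα1 : α < 1) (ha : 0 ≤ a) (hab : a < b)
    (hb : b ≤ r) :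
    ∫ x in a..b, (r - x) ^ (-α) * x ^ (α - 1) ≤
      (∫ x in a..b, (r - x) ^ (-α)) * ((b ^ α - a ^ α) / (α * (b - a))) := by
  obtain ⟨c, hc, hce⟩ := exists_hasDerivAt_eq_slope (fun x : ℝ => x ^ α)
    (fun x => α * x ^ (α - 1)) hab
    (continuousOn_id.rpow_const (fun x _ => Or.inr hα0.le))
    (fun x hx => Real.hasDerivAt_rpow_const (Or.inl (by have := hx.1; linarith)))
  have hg : (b ^ α - a ^ α) / (α * (b - a)) = c ^ (α - 1) := by
    have : b - a ≠ 0 := (sub_pos.2 hab).ne'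
    field_simp at hce ⊢
    linarith
  have hc0 : 0 < c := by have := hc.1; linarith
  have hcr : 0 < r - c := by have := hc.2; linarith
  have hgint : ∫ x in a..b, x ^ (α - 1) = c ^ (α - 1) * (b - a) := by
    rw [integral_rpow (Or.inl (by linarith)), ← hg]
    have : b - a ≠ 0 := (sub_pos.2 hab).ne'
    rw [sub_add_cancel]
    field_simp
  have i1 : IntervalIntegrable (fun x : ℝ => (r - x) ^ (-α) * x ^ (α - 1)) volume a b := by
    apply (aux_int α r hα0 hα1 (by linarith)).mono_set
    rw [Set.uIcc_of_le hab.le, Set.uIcc_of_le (by linarith)]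
    exact Set.Icc_subset_Icc ha hb
  have i2 := aux_int2 α r a b hα1
  have i3 : IntervalIntegrable (fun x : ℝ => x ^ (α - 1)) volume a b :=
    intervalIntegral.intervalIntegrable_rpow' (by linarith)
  have i5 : IntervalIntegrable (fun x : ℝ => x ^ (α - 1) - c ^ (α - 1)) volume a b :=
    i3.sub intervalIntegrable_const
  have key : ∫ x in a..b, (r - x) ^ (-α) * x ^ (α - 1) ≤
      ∫ x in a..b, ((r - x) ^ (-α) * c ^ (α - 1) +
        (r - c) ^ (-α) * (x ^ (α - 1) - c ^ (α - 1))) := by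
    apply intervalIntegral.integral_mono_on_of_le_Ioo hab.le i1
      ((i2.mul_const _).add (i5.const_mul _))
    intro x hx
    have hx0 : 0 < x := by have := hx.1; linarith
    have hxr : 0 < r - x := by have := hx.2; linarith
    rcases le_total x c with h | h
    · have A1 : c ^ (α - 1) ≤ x ^ (α - 1) :=
        Real.rpow_le_rpow_of_nonpos hx0 h (by linarith)
      have A2 : (r - x) ^ (-α) ≤ (r - c) ^ (-α) :=
        Real.rpow_le_rpow_of_nonpos hcr (by linarith) (by linarith)
      nlinarith
    · have A1 : x ^ (α - 1) ≤ c ^ (α - 1) :=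
        Real.rpow_le_rpow_of_nonpos hc0 h (by linarith)
      have A2 : (r - c) ^ (-α) ≤ (r - x) ^ (-α) :=
        Real.rpow_le_rpow_of_nonpos hxr (by linarith) (by linarith)
      nlinarith
  rw [intervalIntegral.integral_add (i2.mul_const _) (i5.const_mul _),
    intervalIntegral.integral_mul_const, intervalIntegral.integral_const_mul,
    intervalIntegral.integral_sub i3 intervalIntegrable_const, hgint,
    intervalIntegral.integral_const, smul_eq_mul] at key
  rw [hg]
  linarith

/-- Under assumptions A1 and A2, the complementary kernels satisfy
`Σ_{j=1}^n P^{(n,ν)}_{n−j} ω_{1+mα−α}(t_j) ≤ π_A ω_{1+mα}(t_n)` for m = 0, 1. -/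
theorem stmt_2 (N : ℕ) (hN : 1 ≤ N) (α ν πA T : ℝ)
    (hα0 : 0 < α) (hα1 : α < 1) (hν0 : 0 ≤ ν) (hν1 : ν < 1/2) (hπA : 0 < πA)
    (t : ℕ → ℝ) (ht0 : t 0 = 0) (htN : t N = T)
    (htmono : ∀ k : ℕ, 1 ≤ k → k ≤ N → t (k-1) < t k)
    (A P : ℕ → ℕ → ℝ)
    (hA1mono : ∀ n k : ℕ, 2 ≤ k → k ≤ n → n ≤ N → A n (k-1) ≤ A n (k-2) ∧ 0 < A n (k-1))
    (hA1first : ∀ n : ℕ, 2 ≤ n → n ≤ N → 0 ≤ (1 - 2*ν) * A n 0 - (1-ν) * A n 1)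
    (hA1pos : ∀ n : ℕ, 1 ≤ n → n ≤ N → 0 < A n 0)
    (hA2 : ∀ n k : ℕ, 1 ≤ k → k ≤ n → n ≤ N →
      (1 / (πA * (t k - t (k-1)))) *
        ∫ s in (t (k-1))..(t k), (t n - s) ^ (-α) / Real.Gamma (1-α) ≤ A n (n-k))
    (hP0 : ∀ n : ℕ, 1 ≤ n → n ≤ N → P n 0 = 1 / A n 0)
    (hPrec : ∀ n j : ℕ, 1 ≤ j → j + 1 ≤ n → n ≤ N →
      P n (n-j) = (1 / A j 0) *
        ∑ k ∈ Finset.Icc (j+1) n, (A k (k-j-1) - A k (k-j)) * P n (n-k))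
    (m : ℕ) (hm : m ≤ 1) (n : ℕ) (hn1 : 1 ≤ n) (hnN : n ≤ N) :
    ∑ j ∈ Finset.Icc 1 n, P n (n-j) * (t j ^ ((m:ℝ)*α - α) / Real.Gamma (1 + (m:ℝ)*α - α))
      ≤ πA * (t n ^ ((m:ℝ)*α) / Real.Gamma (1 + (m:ℝ)*α)) := by
  have hmono : ∀ i j : ℕ, i ≤ j → j ≤ N → t i ≤ t j := by
    intro i j hij
    induction j, hij using Nat.le_induction with
    | base => intro _; exact le_rfl
    | succ j hij ih =>
      intro hj
      have := htmono (j+1) (by omega) hj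
      have h2 := ih (by omega)
      simp only [Nat.add_sub_cancel] at this
      linarith
  have hG1 : 0 < Real.Gamma (1 - α) := Real.Gamma_pos_of_pos (by linarith)
  have hG : 0 < Real.Gamma α := Real.Gamma_pos_of_pos hα0
  have htpos : ∀ j, 1 ≤ j → j ≤ N → 0 < t j := by
    intro j h1 h2
    have a1 := htmono j h1 h2
    have a2 := hmono 0 (j-1) (by omega) (by omega)
    linarith
  have hPnn : ∀ d j : ℕ, 1 ≤ j → j + d = n → 0 ≤ P n (n - j) := by
    intro d
    induction d using Nat.strong_induction_on with
    | _ d ih =>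
      intro j hj hjd
      rcases Nat.eq_zero_or_pos d with h0 | h0
      · have : n - j = 0 := by omega
        rw [this, hP0 n hn1 hnN]
        exact (one_div_pos.2 (hA1pos n hn1 hnN)).le
      · rw [hPrec n j hj (by omega) hnN]
        apply mul_nonneg (one_div_pos.2 (hA1pos j hj (by omega))).le
        apply Finset.sum_nonneg
        intro k hk
        rw [Finset.mem_Icc] at hk
        apply mul_nonneg _ (ih (n - k) (by omega) k (by omega) (by omega))
        have := (hA1mono k (k - j + 1) (by omega) (by omega) (by omega)).1
        have e1 : k - j + 1 - 1 = k - j := by omega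
        have e2 : k - j + 1 - 2 = k - j - 1 := by omega
        rw [e1, e2] at this
        linarith
  have hPn : ∀ j ∈ Finset.Icc 1 n, 0 ≤ P n (n - j) := by
    intro j hj
    rw [Finset.mem_Icc] at hj
    exact hPnn (n - j) j hj.1 (by omega)
  have hid : ∀ d k : ℕ, 1 ≤ k → k + d = n →
      ∑ j ∈ Finset.Icc k n, P n (n - j) * A j (j - k) = 1 := by
    intro d
    induction d with
    | zero =>
      intro k hk hkd
      have : k = n := by omega
      subst this
      have := (hA1pos k hn1 hnN).ne'
      simp [hP0 k hn1 hnN, this]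
    | succ d ih =>
      intro k hk hkd
      have h := ih (k+1) (by omega) (by omega)
      rw [← Finset.add_sum_Ioc_eq_sum_Icc (by omega : k ≤ n), ← Finset.Icc_add_one_left_eq_Ioc,
        hPrec n k hk (by omega) hnN, Nat.sub_self]
      have hne := (hA1pos k hk (by omega)).ne'
      rw [mul_comm, ← mul_assoc, mul_one_div_cancel hne, one_mul, ← Finset.sum_add_distrib, ← h]
      apply Finset.sum_congr rfl
      intro i _
      rw [Nat.sub_sub]
      ring
  -- lower bound from A2
  have hA2' : ∀ j k : ℕ, 1 ≤ k → k ≤ j → j ≤ N →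
      (∫ s in (t (k-1))..(t k), (t j - s) ^ (-α)) ≤
        πA * Real.Gamma (1-α) * (t k - t (k-1)) * A j (j-k) := by
    intro j k h1 h2 h3
    have h := hA2 j k h1 h2 h3
    rw [intervalIntegral.integral_div] at h
    have hτ : 0 < t k - t (k-1) := sub_pos.2 (htmono k h1 (by omega))
    rw [div_mul_div_comm, one_mul, div_le_iff₀ (by positivity)] at h
    linarith
  obtain rfl | rfl : m = 0 ∨ m = 1 := by omega
  · simp only [Nat.cast_zero, zero_mul, add_zero, zero_sub, Real.rpow_zero, Real.Gamma_one]
    rw [div_one, mul_one]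
    have h := hid (n - 1) 1 le_rfl (by omega)
    have : πA = ∑ j ∈ Finset.Icc 1 n, P n (n - j) * (πA * A j (j - 1)) := by
      have h' : πA = πA * ∑ j ∈ Finset.Icc 1 n, P n (n - j) * A j (j - 1) := by rw [h, mul_one]
      refine h'.trans ?_
      rw [Finset.mul_sum]
      apply Finset.sum_congr rfl
      intro i _
      ring
    rw [this]
    apply Finset.sum_le_sum
    intro j hj
    apply mul_le_mul_of_nonneg_left _ (hPn j hj)
    rw [Finset.mem_Icc] at hj
    have hb := hA2' j 1 le_rfl hj.1 (by omega)
    simp only [Nat.sub_self, ht0, sub_zero] at hb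
    have ht1 := htpos 1 le_rfl hN
    have h1j := hmono 1 j hj.1 (by omega)
    have hc : ∫ s in (0:ℝ)..(t 1), (t j) ^ (-α) ≤ ∫ s in (0:ℝ)..(t 1), (t j - s) ^ (-α) := by
      apply intervalIntegral.integral_mono_on_of_le_Ioo ht1.le intervalIntegrable_const
        (aux_int2 α (t j) 0 (t 1) hα1)
      intro x hx
      exact Real.rpow_le_rpow_of_nonpos (by linarith [hx.2]) (by linarith [hx.1]) (by linarith)
    rw [intervalIntegral.integral_const, smul_eq_mul, sub_zero] at hc
    rw [div_le_iff₀ hG1]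
    have := hc.trans hb
    refine le_of_mul_le_mul_left (this.trans (le_of_eq ?_)) ht1
    ring
  · have e : (1:ℝ) + α - α = 1 := by ring
    simp only [Nat.cast_one, one_mul, sub_self, Real.rpow_zero, e, Real.Gamma_one, div_one, mul_one]
    have hlow : ∀ j ∈ Finset.Icc 1 n, 1 ≤ ∑ k ∈ Finset.Icc 1 j,
        πA * ((t k ^ α - t (k-1) ^ α) / (α * Real.Gamma α)) * A j (j - k) := by
      intro j hj
      rw [Finset.mem_Icc] at hj
      have hI := aux_beta α (t j) hα0 hα1 (htpos j hj.1 (by omega))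
      have hII := aux_int α (t j) hα0 hα1 (htpos j hj.1 (by omega))
      have hs := intervalIntegral.sum_integral_adjacent_intervals (a := t) (n := j)
        (f := fun x : ℝ => (t j - x) ^ (-α) * x ^ (α - 1)) (μ := MeasureTheory.volume) (by
          intro k hk
          apply hII.mono_set
          have b0 := hmono 0 k (by omega) (by omega)
          have b1 := hmono k (k+1) (by omega) (by omega)
          have b2 := hmono (k+1) j (by omega) (by omega)
          rw [ht0] at b0
          rw [Set.uIcc_of_le b1, Set.uIcc_of_le (by linarith)]
          exact Set.Icc_subset_Icc b0 b2)
      rw [ht0, hI] at hs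
      have hpos : 0 < Real.Gamma α * Real.Gamma (1 - α) := by positivity
      refine le_of_mul_le_mul_left ?_ hpos
      rw [mul_one]
      nth_rewrite 1 [← hs]
      rw [aux_sum, Finset.mul_sum]
      apply Finset.sum_le_sum
      intro k hk
      rw [Finset.mem_range] at hk
      have b0 := hmono 0 k (by omega) (by omega)
      have b1 := htmono (k+1) (by omega) (by omega)
      have b2 := hmono (k+1) j (by omega) (by omega)
      have h2 := hA2' j (k+1) (by omega) (by omega) (by omega)
      rw [Nat.add_sub_cancel] at b1 h2 ⊢
      rw [ht0] at b0
      refine (aux_cheb α (t j) (t k) (t (k+1)) hα0 hα1 b0 b1 b2).trans ?_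
      have hτ : 0 < t (k+1) - t k := sub_pos.2 b1
      have hv : 0 ≤ t (k+1) ^ α - t k ^ α :=
        sub_nonneg.2 (Real.rpow_le_rpow b0 b1.le hα0.le)
      refine (mul_le_mul_of_nonneg_right h2 (by positivity)).trans (le_of_eq ?_)
      field_simp
    calc ∑ j ∈ Finset.Icc 1 n, P n (n - j)
        ≤ ∑ j ∈ Finset.Icc 1 n, P n (n - j) * ∑ k ∈ Finset.Icc 1 j,
          πA * ((t k ^ α - t (k-1) ^ α) / (α * Real.Gamma α)) * A j (j - k) :=
          Finset.sum_le_sum fun j hj => le_mul_of_one_le_right (hPn j hj) (hlow j hj)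
      _ = ∑ k ∈ Finset.Icc 1 n, πA * ((t k ^ α - t (k-1) ^ α) / (α * Real.Gamma α)) *
          ∑ j ∈ Finset.Icc k n, P n (n - j) * A j (j - k) := by
          simp only [Finset.mul_sum]
          rw [Finset.sum_comm' (t' := Finset.Icc 1 n) (s' := fun k => Finset.Icc k n)]
          · apply Finset.sum_congr rfl
            intro k _
            apply Finset.sum_congr rfl
            intro j _
            ring
          · intro x y
            simp only [Finset.mem_Icc]
            omega
      _ = ∑ k ∈ Finset.Icc 1 n, πA * ((t k ^ α - t (k-1) ^ α) / (α * Real.Gamma α)) := by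
          apply Finset.sum_congr rfl
          intro k hk
          rw [Finset.mem_Icc] at hk
          rw [hid (n - k) k hk.1 (by omega), mul_one]
      _ = πA * (t n ^ α / Real.Gamma (1 + α)) := by
          rw [← Finset.mul_sum, ← Finset.sum_div, aux_sum]
          simp only [Nat.add_sub_cancel]
          rw [Finset.sum_range_sub (fun k => t k ^ α), ht0, Real.zero_rpow hα0.ne', sub_zero,
            add_comm, Real.Gamma_add_one hα0.ne']
      _ ≤ _ := le_rfl
end

section
/- (Grönwall inequality without reaction term.) Let 0 < α < 1, ν ∈ [0,1/2), and let the kernels A^{(n,ν)}_{n−k} on a mesh 0 = t_0 < ⋯ < t_N = T satisfy only assumptions A1 and A2 (with constant π_A); no restriction on the time steps is required. Let (ξ^n)_{n=1}^N and (η^n)_{n=1}^N be nonnegative. If a nonnegative sequence (v^k)_{k=0}^N satisfies Σ_{k=1}^n A^{(n,ν)}_{n−k} ((v^k)² − (v^{k−1})²) ≤ v^{n−ν} ξ^n + (η^n)² for all 1 ≤ n ≤ N, then for all 1 ≤ n ≤ N: v^n ≤ v^0 + max_{1≤k≤n} Σ_{j=1}^k P^{(k,ν)}_{k−j} ξ^j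 + √(π_A Γ(1−α)) max_{1≤k≤n}{ t_k^{α/2} η^k } ≤ v^0 + π_A Γ(1−α) max_{1≤j≤n}{ t_j^α ξ^j } + √(π_A Γ(1−α)) max_{1≤k≤n}{ t_k^{α/2} η^k }. -/
lemma aux_Q (N : ℕ) (A P : ℕ → ℕ → ℝ)
    (hA1pos : ∀ n : ℕ, 1 ≤ n → n ≤ N → 0 < A n 0)
    (hP0 : ∀ n : ℕ, 1 ≤ n → n ≤ N → P n 0 = 1 / A n 0)
    (hPrec : ∀ n j : ℕ, 1 ≤ j → j + 1 ≤ n → n ≤ N →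
      P n (n-j) = (1 / A j 0) *
        ∑ k ∈ Finset.Icc (j+1) n, (A k (k-j-1) - A k (k-j)) * P n (n-k))
    (n : ℕ) (hn : n ≤ N) (d : ℕ) : ∀ k : ℕ, 1 ≤ k → k + d = n →
      ∑ j ∈ Finset.Icc k n, P n (n-j) * A j (j-k) = 1 := by
  induction d with
  | zero =>
    intro k hk hkn
    obtain rfl : k = n := by omega
    have := hA1pos k hk hn
    simp [hP0 k hk hn, this.ne']
  | succ d ih =>
    intro k hk hkn
    have h1 := ih (k+1) (by omega) (by omega)
    have hA := hA1pos k hk (by omega)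
    have h2 : P n (n-k) * A k 0 =
        ∑ j ∈ Finset.Icc (k+1) n, (A j (j-k-1) - A j (j-k)) * P n (n-j) := by
      rw [hPrec n k hk (by omega) hn]; field_simp
    rw [← Finset.add_sum_Ioc_eq_sum_Icc (by omega), ← Finset.Icc_add_one_left_eq_Ioc, Nat.sub_self,
      h2, ← Finset.sum_add_distrib, ← h1]
    refine Finset.sum_congr rfl fun j _ => ?_
    rw [Nat.sub_sub]; ring

lemma aux_Ppos (N : ℕ) (A P : ℕ → ℕ → ℝ)
    (hA1mono : ∀ n k : ℕ, 2 ≤ k → k ≤ n → n ≤ N → A n (k-1) ≤ A n (k-2) ∧ 0 < A n (k-1))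
    (hA1pos : ∀ n : ℕ, 1 ≤ n → n ≤ N → 0 < A n 0)
    (hP0 : ∀ n : ℕ, 1 ≤ n → n ≤ N → P n 0 = 1 / A n 0)
    (hPrec : ∀ n j : ℕ, 1 ≤ j → j + 1 ≤ n → n ≤ N →
      P n (n-j) = (1 / A j 0) *
        ∑ k ∈ Finset.Icc (j+1) n, (A k (k-j-1) - A k (k-j)) * P n (n-k))
    (n : ℕ) (hn : n ≤ N) (d : ℕ) : d < n → 0 ≤ P n d := by
  induction d using Nat.strong_induction_on with
  | _ d ih =>
    intro hd
    rcases Nat.eq_zero_or_pos d with rfl | hd0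
    · rw [hP0 n (by omega) hn]; exact (one_div_pos.2 (hA1pos n (by omega) hn)).le
    · have h := hPrec n (n-d) (by omega) (by omega) hn
      rw [show n - (n-d) = d by omega] at h
      rw [h]
      refine mul_nonneg (one_div_pos.2 (hA1pos (n-d) (by omega) (by omega))).le
        (Finset.sum_nonneg fun k hk => ?_)
      rw [Finset.mem_Icc] at hk
      have := (hA1mono k (k-(n-d)+1) (by omega) (by omega) (by omega)).1
      rw [show k-(n-d)+1-1 = k-(n-d) by omega, show k-(n-d)+1-2 = k-(n-d)-1 by omega] at this
      exact mul_nonneg (by linarith) (ih (n-k) (by omega) (by omega))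

lemma aux_int_s5 (α a b : ℝ) (hα0 : 0 < α) (hα1 : α < 1) (ha : 0 < a) (hab : a ≤ b) :
    a * (b ^ (-α) / Real.Gamma (1-α)) ≤ ∫ s in (0:ℝ)..a, (b - s) ^ (-α) / Real.Gamma (1-α) := by
  have hG : 0 < Real.Gamma (1-α) := Real.Gamma_pos_of_pos (by linarith)
  have hi : IntervalIntegrable (fun s : ℝ => (b - s) ^ (-α) / Real.Gamma (1-α))
      MeasureTheory.volume 0 a := by
    apply IntervalIntegrable.div_const
    have := (intervalIntegral.intervalIntegrable_rpow' (a := b) (b := b - a)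
      (r := -α) (by linarith)).comp_sub_left b
    simpa using this
  have h := intervalIntegral.integral_mono_on_of_le_Ioo (μ := MeasureTheory.volume)
    (f := fun _ => b ^ (-α) / Real.Gamma (1-α)) ha.le (by simp) hi (by
      intro s hs
      have := Real.rpow_le_rpow_of_nonpos (x := b - s) (y := b) (z := -α)
        (by linarith [hs.2]) (by linarith [hs.1]) (by linarith)
      gcongr)
  simpa [mul_div_assoc] using h

lemma aux_sum_s5 (N : ℕ) (w B : ℕ → ℕ → ℝ) (u : ℕ → ℝ) (n : ℕ)
    (hQ : ∀ k, 1 ≤ k → k ≤ n → ∑ j ∈ Finset.Icc k n, w n (n-j) * B j (j-k) = 1) :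
    ∑ j ∈ Finset.Icc 1 n, w n (n-j) * ∑ k ∈ Finset.Icc 1 j, B j (j-k) * u k =
      ∑ k ∈ Finset.Icc 1 n, u k := by
  simp_rw [Finset.mul_sum]
  rw [Finset.sum_comm' (t' := Finset.Icc 1 n) (s' := fun k => Finset.Icc k n)
    (by intro x y; simp only [Finset.mem_Icc]; omega)]
  refine Finset.sum_congr rfl fun k hk => ?_
  rw [Finset.mem_Icc] at hk
  have h := congrArg (fun x => x * u k) (hQ k hk.1 hk.2)
  simp only [Finset.sum_mul, one_mul] at h
  refine Eq.trans ?_ h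
  exact Finset.sum_congr rfl fun j _ => by ring


/-- Grönwall inequality without a reaction term: only A1 and A2 are assumed,
with no restriction on the time steps. -/
theorem stmt_5 (N : ℕ) (hN : 1 ≤ N) (α ν πA T : ℝ)
    (hα0 : 0 < α) (hα1 : α < 1) (hν0 : 0 ≤ ν) (hν1 : ν < 1/2) (hπA : 0 < πA)
    (t : ℕ → ℝ) (ht0 : t 0 = 0) (htN : t N = T)
    (htmono : ∀ k : ℕ, 1 ≤ k → k ≤ N → t (k-1) < t k)
    (A P : ℕ → ℕ → ℝ)
    (hA1mono : ∀ n k : ℕ, 2 ≤ k → k ≤ n → n ≤ N → A n (k-1) ≤ A n (k-2) ∧ 0 < A n (k-1))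
    (hA1first : ∀ n : ℕ, 2 ≤ n → n ≤ N → 0 ≤ (1 - 2*ν) * A n 0 - (1-ν) * A n 1)
    (hA1pos : ∀ n : ℕ, 1 ≤ n → n ≤ N → 0 < A n 0)
    (hA2 : ∀ n k : ℕ, 1 ≤ k → k ≤ n → n ≤ N →
      (1 / (πA * (t k - t (k-1)))) *
        ∫ s in (t (k-1))..(t k), (t n - s) ^ (-α) / Real.Gamma (1-α) ≤ A n (n-k))
    (hP0 : ∀ n : ℕ, 1 ≤ n → n ≤ N → P n 0 = 1 / A n 0)
    (hPrec : ∀ n j : ℕ, 1 ≤ j → j + 1 ≤ n → n ≤ N →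
      P n (n-j) = (1 / A j 0) *
        ∑ k ∈ Finset.Icc (j+1) n, (A k (k-j-1) - A k (k-j)) * P n (n-k))
    (ξ η : ℕ → ℝ)
    (hξ : ∀ n : ℕ, 1 ≤ n → n ≤ N → 0 ≤ ξ n)
    (hη : ∀ n : ℕ, 1 ≤ n → n ≤ N → 0 ≤ η n)
    (v : ℕ → ℝ) (hv : ∀ k : ℕ, k ≤ N → 0 ≤ v k)
    (hineq : ∀ n : ℕ, 1 ≤ n → n ≤ N →
      ∑ k ∈ Finset.Icc 1 n, A n (n-k) * ((v k)^2 - (v (k-1))^2) ≤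
        (ν * v (n-1) + (1-ν) * v n) * ξ n + (η n)^2)
    (n : ℕ) (hn1 : 1 ≤ n) (hnN : n ≤ N) :
    v n ≤ v 0 + (Finset.Icc 1 n).sup' (Finset.nonempty_Icc.mpr hn1)
            (fun k => ∑ j ∈ Finset.Icc 1 k, P k (k-j) * ξ j)
          + Real.sqrt (πA * Real.Gamma (1-α)) *
            (Finset.Icc 1 n).sup' (Finset.nonempty_Icc.mpr hn1) (fun k => t k ^ (α/2) * η k) ∧
      v 0 + (Finset.Icc 1 n).sup' (Finset.nonempty_Icc.mpr hn1)
            (fun k => ∑ j ∈ Finset.Icc 1 k, P k (k-j) * ξ j)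
          + Real.sqrt (πA * Real.Gamma (1-α)) *
            (Finset.Icc 1 n).sup' (Finset.nonempty_Icc.mpr hn1) (fun k => t k ^ (α/2) * η k)
        ≤ v 0 + πA * Real.Gamma (1-α) *
            (Finset.Icc 1 n).sup' (Finset.nonempty_Icc.mpr hn1) (fun j => t j ^ α * ξ j)
          + Real.sqrt (πA * Real.Gamma (1-α)) *
            (Finset.Icc 1 n).sup' (Finset.nonempty_Icc.mpr hn1) (fun k => t k ^ (α/2) * η k) := by
  have hG : 0 < Real.Gamma (1-α) := Real.Gamma_pos_of_pos (by linarith)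
  have hC : 0 < πA * Real.Gamma (1-α) := mul_pos hπA hG
  have hQ : ∀ m, m ≤ N → ∀ k, 1 ≤ k → k ≤ m →
      ∑ j ∈ Finset.Icc k m, P m (m-j) * A j (j-k) = 1 := fun m hm k hk hkm =>
    aux_Q N A P hA1pos hP0 hPrec m hm (m-k) k hk (by omega)
  have hP : ∀ m, m ≤ N → ∀ j, 1 ≤ j → j ≤ m → 0 ≤ P m (m-j) := fun m hm j hj hjm =>
    aux_Ppos N A P hA1mono hA1pos hP0 hPrec m hm (m-j) (by omega)
  have ht1 : ∀ j, 1 ≤ j → j ≤ N → t 1 ≤ t j := by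
    intro j hj
    induction j, hj using Nat.le_induction with
    | base => intro _; exact le_rfl
    | succ j hj ih =>
      intro h
      have := htmono (j+1) (by omega) h
      simp only [Nat.add_sub_cancel] at this
      linarith [ih (by omega)]
  have ht1p : 0 < t 1 := by have := htmono 1 le_rfl hN; simpa [ht0] using this
  have htp : ∀ j, 1 ≤ j → j ≤ N → 0 < t j := fun j h1 h2 => ht1p.trans_le (ht1 j h1 h2)
  have hAlow : ∀ j, 1 ≤ j → j ≤ N → 1 ≤ (πA * Real.Gamma (1-α)) * t j ^ α * A j (j-1) := by
    intro j h1 h2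
    have h := hA2 j 1 le_rfl h1 h2
    simp only [Nat.sub_self, ht0, sub_zero] at h
    have h' := aux_int_s5 α (t 1) (t j) hα0 hα1 ht1p (ht1 j h1 h2)
    have h3 : (1 / (πA * t 1)) * (t 1 * (t j ^ (-α) / Real.Gamma (1-α))) ≤ A j (j-1) :=
      le_trans (mul_le_mul_of_nonneg_left h' (by positivity)) h
    have hp : 0 < t j ^ α := Real.rpow_pos_of_pos (htp j h1 h2) _
    rw [Real.rpow_neg (htp j h1 h2).le] at h3
    calc (1:ℝ) = (πA * Real.Gamma (1-α)) * t j ^ α *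
          ((1 / (πA * t 1)) * (t 1 * ((t j ^ α)⁻¹ / Real.Gamma (1-α)))) := by
            field_simp
      _ ≤ _ := mul_le_mul_of_nonneg_left h3 (by positivity)
  -- weighted sums
  have hW : ∀ m, 1 ≤ m → m ≤ N → ∀ (f : ℕ → ℝ) (M : ℝ), (∀ j, 1 ≤ j → j ≤ m → 0 ≤ f j) →
      (∀ j, 1 ≤ j → j ≤ m → t j ^ α * f j ≤ M) →
      ∑ j ∈ Finset.Icc 1 m, P m (m-j) * f j ≤ πA * Real.Gamma (1-α) * M := by
    intro m h1 h2 f M hf hM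
    calc ∑ j ∈ Finset.Icc 1 m, P m (m-j) * f j
        ≤ ∑ j ∈ Finset.Icc 1 m, (P m (m-j) * A j (j-1)) * (πA * Real.Gamma (1-α) * M) := by
          refine Finset.sum_le_sum fun j hj => ?_
          rw [Finset.mem_Icc] at hj
          rw [mul_assoc]
          refine mul_le_mul_of_nonneg_left ?_ (hP m h2 j hj.1 hj.2)
          have ha := hAlow j hj.1 (by omega)
          have hp : 0 < t j ^ α := Real.rpow_pos_of_pos (htp j hj.1 (by omega)) _
          have hApos : 0 < A j (j-1) := by
            by_contra hcon
            push Not at hcon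
            have := mul_nonpos_of_nonneg_of_nonpos (mul_pos hC hp).le hcon
            linarith
          calc f j ≤ ((πA * Real.Gamma (1-α)) * t j ^ α * A j (j-1)) * f j :=
                le_mul_of_one_le_left (hf j hj.1 hj.2) ha
            _ = A j (j-1) * (πA * Real.Gamma (1-α) * (t j ^ α * f j)) := by ring
            _ ≤ _ := by
              have := hM j hj.1 hj.2
              gcongr
      _ = _ := by rw [← Finset.sum_mul, hQ m h2 1 le_rfl h1, one_mul]
  refine ⟨?_, ?_⟩
  · set X := (Finset.Icc 1 n).sup' (Finset.nonempty_Icc.mpr hn1)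
            (fun k => ∑ j ∈ Finset.Icc 1 k, P k (k-j) * ξ j) with hX
    set E := (Finset.Icc 1 n).sup' (Finset.nonempty_Icc.mpr hn1)
            (fun k => t k ^ (α/2) * η k) with hE
    have hXle : ∀ k, 1 ≤ k → k ≤ n → ∑ j ∈ Finset.Icc 1 k, P k (k-j) * ξ j ≤ X :=
      fun k h1 h2 => Finset.le_sup' (fun k => ∑ j ∈ Finset.Icc 1 k, P k (k-j) * ξ j)
        (Finset.mem_Icc.2 ⟨h1, h2⟩)
    have hEle : ∀ k, 1 ≤ k → k ≤ n → t k ^ (α/2) * η k ≤ E :=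
      fun k h1 h2 => Finset.le_sup' (fun k => t k ^ (α/2) * η k) (Finset.mem_Icc.2 ⟨h1, h2⟩)
    have hX0 : 0 ≤ X := (Finset.sum_nonneg fun j hj => by
      rw [Finset.mem_Icc] at hj
      exact mul_nonneg (hP n hnN j hj.1 hj.2) (hξ j hj.1 (by omega))).trans (hXle n hn1 le_rfl)
    have hE0 : 0 ≤ E := (mul_nonneg (Real.rpow_nonneg (htp n hn1 hnN).le _)
      (hη n hn1 hnN)).trans (hEle n hn1 le_rfl)
    have hS : 0 ≤ Real.sqrt (πA * Real.Gamma (1-α)) := Real.sqrt_nonneg _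
    have hSS : Real.sqrt (πA * Real.Gamma (1-α)) ^ 2 = πA * Real.Gamma (1-α) :=
      Real.sq_sqrt hC.le
    obtain ⟨m, hm, hmax⟩ := Finset.exists_max_image (Finset.range (n+1)) v ⟨0, by simp⟩
    rw [Finset.mem_range] at hm
    have hmax' : ∀ k, k ≤ n → v k ≤ v m := fun k hk => hmax k (Finset.mem_range.2 (by omega))
    have hSE := mul_nonneg hS hE0
    refine (hmax' n le_rfl).trans ?_
    rcases Nat.eq_zero_or_pos m with rfl | hm0
    · linarith
    have hmN : m ≤ N := by omega
    have hvm := hv m hmN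
    have hv0 := hv 0 (by omega)
    have key : v m ^ 2 ≤ v 0 ^ 2 + v m * X + (Real.sqrt (πA * Real.Gamma (1-α)) * E) ^ 2 := by
      have e1 := aux_sum_s5 N P A (fun k => v k ^ 2 - v (k-1) ^ 2) m (hQ m hmN)
      have e2 : ∑ k ∈ Finset.Icc 1 m, (v k ^ 2 - v (k-1) ^ 2) = v m ^ 2 - v 0 ^ 2 := by
        clear * - 
        induction m with
        | zero => simp
        | succ m ih => rw [Finset.sum_Icc_succ_top (by omega), ih]; simp
      have e3 : ∑ j ∈ Finset.Icc 1 m, P m (m-j) *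
            ∑ k ∈ Finset.Icc 1 j, A j (j-k) * (v k ^ 2 - v (k-1) ^ 2) ≤
          v m * (∑ j ∈ Finset.Icc 1 m, P m (m-j) * ξ j) +
            ∑ j ∈ Finset.Icc 1 m, P m (m-j) * (η j)^2 := by
        rw [Finset.mul_sum, ← Finset.sum_add_distrib]
        refine Finset.sum_le_sum fun j hj => ?_
        rw [Finset.mem_Icc] at hj
        have hx := hξ j hj.1 (by omega)
        have hb : ν * v (j-1) + (1-ν) * v j ≤ v m := by
          have a1 := hmax' (j-1) (by omega)
          have a2 := hmax' j (by omega)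
          nlinarith
        calc _ ≤ P m (m-j) * (v m * ξ j + (η j)^2) := by
              refine mul_le_mul_of_nonneg_left ((hineq j hj.1 (by omega)).trans ?_)
                (hP m hmN j hj.1 hj.2)
              gcongr
          _ = _ := by ring
      have e4 := hW m hm0 hmN (fun j => (η j)^2) (E^2) (fun j _ _ => sq_nonneg _) (by
        intro j h1 h2
        have hh := hEle j h1 (by omega)
        have hpp : t j ^ α = (t j ^ (α/2))^2 := by
          rw [← Real.rpow_natCast, ← Real.rpow_mul (htp j h1 (by omega)).le]; norm_num
        have h0 : 0 ≤ t j ^ (α/2) * η j := mul_nonneg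
          (Real.rpow_nonneg (htp j h1 (by omega)).le _) (hη j h1 (by omega))
        rw [hpp, ← mul_pow]
        gcongr)
      have e5 := mul_le_mul_of_nonneg_left (hXle m hm0 (by omega)) hvm
      rw [mul_pow, hSS]
      linarith
    generalize Real.sqrt (πA * Real.Gamma (1-α)) * E = Y at key hSE
    by_contra hcon
    push Not at hcon
    have h0 := hmax' 0 (by omega)
    nlinarith [mul_nonneg hv0 (sub_nonneg.2 h0), mul_nonneg hSE (by linarith : 0 ≤ v m - Y),
      mul_nonneg hvm (by linarith : 0 ≤ v m - (v 0 + X + Y)),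
      mul_pos (by linarith : 0 < v m) (by linarith : 0 < v m - (v 0 + X + Y))]
  · gcongr
    refine Finset.sup'_le _ _ fun k hk => ?_
    rw [Finset.mem_Icc] at hk
    exact hW k hk.1 (by omega) ξ _ (fun j h1 h2 => hξ j h1 (by omega)) fun j h1 h2 =>
      Finset.le_sup' (fun j => t j ^ α * ξ j) (Finset.mem_Icc.2 ⟨h1, by omega⟩)
end

section
/- Let 0 < α < 1, ν ∈ [0,1/2), and let the kernels A^{(n,ν)}_{n−k} on a mesh 0 = t_0 < ⋯ < t_N = T satisfy assumptions A1 and A2 (with constant π_A). Then for every nonnegative sequence (ξ^j)_{j=1}^N and every 1 ≤ k ≤ N, the complementary kernels satisfy Σ_{j=1}^k P^{(k,ν)}_{k−j} ξ^j ≤ π_A max_{1≤j≤k} ( ξ^j / ω_{1−α}(t_j) ) = π_A Γ(1−α) max_{1≤j≤k} ( t_j^α ξ^j ). -/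
/-- bound for `Σ_{j=1}^k P^{(k,ν)}_{k−j} ξ^j` in terms of
`π_A max_{1≤j≤k}(ξ^j/ω_{1−α}(t_j)) = π_A Γ(1−α) max_{1≤j≤k}(t_j^α ξ^j)`. -/
theorem stmt_6 (N : ℕ) (hN : 1 ≤ N) (α ν πA T : ℝ)
    (hα0 : 0 < α) (hα1 : α < 1) (hν0 : 0 ≤ ν) (hν1 : ν < 1/2) (hπA : 0 < πA)
    (t : ℕ → ℝ) (ht0 : t 0 = 0) (htN : t N = T)
    (htmono : ∀ k : ℕ, 1 ≤ k → k ≤ N → t (k-1) < t k)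
    (A P : ℕ → ℕ → ℝ)
    (hA1mono : ∀ n k : ℕ, 2 ≤ k → k ≤ n → n ≤ N → A n (k-1) ≤ A n (k-2) ∧ 0 < A n (k-1))
    (hA1first : ∀ n : ℕ, 2 ≤ n → n ≤ N → 0 ≤ (1 - 2*ν) * A n 0 - (1-ν) * A n 1)
    (hA1pos : ∀ n : ℕ, 1 ≤ n → n ≤ N → 0 < A n 0)
    (hA2 : ∀ n k : ℕ, 1 ≤ k → k ≤ n → n ≤ N →
      (1 / (πA * (t k - t (k-1)))) *
        ∫ s in (t (k-1))..(t k), (t n - s) ^ (-α) / Real.Gamma (1-α) ≤ A n (n-k))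
    (hP0 : ∀ n : ℕ, 1 ≤ n → n ≤ N → P n 0 = 1 / A n 0)
    (hPrec : ∀ n j : ℕ, 1 ≤ j → j + 1 ≤ n → n ≤ N →
      P n (n-j) = (1 / A j 0) *
        ∑ k ∈ Finset.Icc (j+1) n, (A k (k-j-1) - A k (k-j)) * P n (n-k))
    (ξ : ℕ → ℝ) (hξ : ∀ j : ℕ, 1 ≤ j → j ≤ N → 0 ≤ ξ j)
    (k : ℕ) (hk1 : 1 ≤ k) (hkN : k ≤ N) :
    ∑ j ∈ Finset.Icc 1 k, P k (k-j) * ξ j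
      ≤ πA * (Finset.Icc 1 k).sup' (Finset.nonempty_Icc.mpr hk1)
          (fun j => ξ j / (t j ^ (-α) / Real.Gamma (1-α))) ∧
    πA * (Finset.Icc 1 k).sup' (Finset.nonempty_Icc.mpr hk1)
        (fun j => ξ j / (t j ^ (-α) / Real.Gamma (1-α)))
      = πA * Real.Gamma (1-α) *
          (Finset.Icc 1 k).sup' (Finset.nonempty_Icc.mpr hk1) (fun j => t j ^ α * ξ j) := by
  have hG : 0 < Real.Gamma (1-α) := Real.Gamma_pos_of_pos (by linarith)
  have htpos : ∀ j, 1 ≤ j → j ≤ N → 0 < t j ∧ t 1 ≤ t j := by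
    intro j hj
    induction j, hj using Nat.le_induction with
    | base =>
      intro h
      have := htmono 1 le_rfl h
      simp only [Nat.sub_self, ht0] at this
      exact ⟨this, le_rfl⟩
    | succ j hj ih =>
      intro h
      have h1 := htmono (j+1) (by omega) h
      have h2 := ih (by omega)
      simp only [Nat.add_sub_cancel] at h1
      exact ⟨by linarith, by linarith⟩
  have hPnn : ∀ d, d < k → 0 ≤ P k d := by
    intro d
    induction d using Nat.strong_induction_on with
    | _ d ih =>
      intro hd
      rcases Nat.eq_zero_or_pos d with h0 | h0
      · subst h0
        rw [hP0 k hk1 hkN]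
        exact (one_div_pos.mpr (hA1pos k hk1 hkN)).le
      · have h := hPrec k (k-d) (by omega) (by omega) hkN
        rw [show k - (k-d) = d by omega] at h
        rw [h]
        refine mul_nonneg (one_div_pos.mpr (hA1pos _ (by omega) (by omega))).le
          (Finset.sum_nonneg ?_)
        intro i hi
        rw [Finset.mem_Icc] at hi
        refine mul_nonneg ?_ (ih _ (by omega) (by omega))
        have h3 := (hA1mono i (i-(k-d)+1) (by omega) (by omega) (by omega)).1
        rw [show i-(k-d)+1-1 = i-(k-d) by omega,
          show i-(k-d)+1-2 = i-(k-d)-1 by omega] at h3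
        linarith
  have horth : ∀ d, d < k →
      ∑ j ∈ Finset.Icc (k-d) k, P k (k-j) * A j (j-(k-d)) = 1 := by
    intro d
    induction d with
    | zero =>
      intro _
      have := hA1pos k hk1 hkN
      simp [hP0 k hk1 hkN, this.ne']
    | succ d ih =>
      intro hd
      obtain ⟨m, hm⟩ : ∃ m, m = k-(d+1) := ⟨_, rfl⟩
      have ih := ih (by omega)
      rw [show k - d = m+1 by omega] at ih
      rw [← hm]
      have h := hPrec k m (by omega) (by omega) hkN
      have hA := hA1pos m (by omega) (by omega)
      rw [← Finset.add_sum_Ioc_eq_sum_Icc (by omega : m ≤ k), h]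
      rw [show Finset.Ioc m k = Finset.Icc (m+1) k by ext; simp only [Finset.mem_Ioc, Finset.mem_Icc]; omega]
      rw [Nat.sub_self]
      have e : ∀ S : ℝ, 1 / A m 0 * S * A m 0 = S := by intro S; field_simp
      rw [e, ← Finset.sum_add_distrib, ← ih]
      refine Finset.sum_congr rfl fun j _ => ?_
      rw [show j - (m+1) = j - m - 1 by omega]
      ring
  have hAlow : ∀ j, 1 ≤ j → j ≤ N →
      t j ^ (-α) / Real.Gamma (1-α) ≤ πA * A j (j-1) := by
    intro j hj hjN
    have h := hA2 j 1 le_rfl hj hjN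
    have h1 := (htpos 1 le_rfl hN).1
    obtain ⟨hj0, hj1⟩ := htpos j hj hjN
    simp only [Nat.sub_self, ht0, sub_zero] at h
    have hint : ∫ s in (0:ℝ)..(t 1), t j ^ (-α) / Real.Gamma (1-α) ≤
        ∫ s in (0:ℝ)..(t 1), (t j - s) ^ (-α) / Real.Gamma (1-α) := by
      refine intervalIntegral.integral_mono_on_of_le_Ioo h1.le (by simp) ?_ ?_
      · refine IntervalIntegrable.div_const ?_ _
        have := (intervalIntegral.intervalIntegrable_rpow' (a := t j - 0) (b := t j - t 1)
          (r := -α) (by linarith)).comp_sub_left (t j)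
        simpa using this
      · intro s hs
        have := hs.1
        have := hs.2
        gcongr ?_ / _
        exact Real.rpow_le_rpow_of_nonpos (by linarith) (by linarith) (by linarith)
    rw [intervalIntegral.integral_const, smul_eq_mul, sub_zero] at hint
    have h2 : 1 / (πA * t 1) * (t 1 * (t j ^ (-α) / Real.Gamma (1-α))) ≤ A j (j-1) :=
      le_trans (mul_le_mul_of_nonneg_left hint (by positivity)) h
    have h3 := mul_le_mul_of_nonneg_left h2 hπA.le
    refine le_trans (le_of_eq ?_) h3
    field_simp
  refine ⟨?_, ?_⟩
  · set M := (Finset.Icc 1 k).sup' (Finset.nonempty_Icc.mpr hk1)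
          (fun j => ξ j / (t j ^ (-α) / Real.Gamma (1-α))) with hM
    have hle : ∀ j ∈ Finset.Icc 1 k, ξ j / (t j ^ (-α) / Real.Gamma (1-α)) ≤ M :=
      fun j hj => Finset.le_sup' (fun j => ξ j / (t j ^ (-α) / Real.Gamma (1-α))) hj
    have hω : ∀ j ∈ Finset.Icc 1 k, 0 < t j ^ (-α) / Real.Gamma (1-α) := by
      intro j hj
      rw [Finset.mem_Icc] at hj
      exact div_pos (Real.rpow_pos_of_pos (htpos j hj.1 (by omega)).1 _) hG
    have hM0 : 0 ≤ M := by
      have h1 : 1 ∈ Finset.Icc 1 k := Finset.mem_Icc.mpr ⟨le_rfl, hk1⟩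
      exact le_trans (div_nonneg (hξ 1 le_rfl hN) (hω 1 h1).le) (hle 1 h1)
    have ho := horth (k-1) (by omega)
    rw [show k-(k-1) = 1 by omega] at ho
    calc ∑ j ∈ Finset.Icc 1 k, P k (k-j) * ξ j
        ≤ ∑ j ∈ Finset.Icc 1 k, (πA * M) * (P k (k-j) * A j (j-1)) := by
          refine Finset.sum_le_sum fun j hj => ?_
          have h1 := (div_le_iff₀ (hω j hj)).mp (hle j hj)
          rw [Finset.mem_Icc] at hj
          have h2 := mul_le_mul_of_nonneg_left (hAlow j hj.1 (by omega)) hM0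
          have h3 := mul_le_mul_of_nonneg_left (h1.trans h2) (hPnn (k-j) (by omega))
          linarith
      _ = πA * M := by rw [← Finset.mul_sum, ho, mul_one]
  · rw [mul_assoc, Finset.mul₀_sup' hG.le]
    congr 1
    refine Finset.sup'_congr _ rfl fun j hj => ?_
    rw [Finset.mem_Icc] at hj
    have h0 := (htpos j hj.1 (by omega)).1
    have := Real.rpow_pos_of_pos h0 α
    rw [Real.rpow_neg h0.le]
    field_simp
end

section
/- (Monotonicity of the L1 kernels.) Let 0 < α < 1 and let 0 = t_0 < t_1 < ⋯ < t_N = T be an arbitrary mesh with steps τ_k := t_k − t_{k−1}. For fixed n ≥ 2, the L1 discrete kernels A^{(n,0)}_{n−k} := (ω_{2−α}(t_n − t_{k−1}) − ω_{2−α}(t_n − t_k))/τ_k satisfy A^{(n,0)}_{n−k−1} − A^{(n,0)}_{n−k} > (1/2)( ω_{1−α}(t_n − t_k) − ω_{1−α}(t_n − t_{k−1}) ) > 0 for all 1 ≤ k ≤ n−1. -/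
/-- `ω_β(x) = x^(β-1)/Γ(β)`. -/
noncomputable def om (β x : ℝ) : ℝ := x ^ (β - 1) / Real.Gamma β

/-- L1 discrete kernel: `L1K α t n k = A^{(n,0)}_{n-k}`. -/
noncomputable def L1K (α : ℝ) (t : ℕ → ℝ) (n k : ℕ) : ℝ :=
  (om (2 - α) (t n - t (k-1)) - om (2 - α) (t n - t k)) / (t k - t (k-1))

theorem aux_tangent (α b x : ℝ) (hα0 : 0 < α) (hb : 0 < b) (hbx : b < x) :
    0 < b ^ (-α) - x ^ (-α) - α * (x - b) * x ^ (-α - 1) := by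
  have hx : 0 < x := hb.trans hbx
  have h := one_add_mul_self_lt_rpow_one_add (s := x / b - 1) (p := 1 + α)
    (by have : 0 < x / b := by positivity
        linarith) (by
      have : 1 < x / b := by rwa [one_lt_div hb]
      linarith) (by linarith)
  rw [add_sub_cancel, Real.div_rpow hx.le hb.le] at h
  have e1 : x ^ (1 + α) = x * x ^ α := by rw [Real.rpow_add hx, Real.rpow_one]
  have e2 : b ^ (1 + α) = b * b ^ α := by rw [Real.rpow_add hb, Real.rpow_one]
  have e3 : x ^ (-α - 1) = (x ^ α)⁻¹ / x := by
    rw [Real.rpow_sub hx, Real.rpow_one, Real.rpow_neg hx.le]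
  rw [e1, e2] at h
  rw [e3, Real.rpow_neg hx.le, Real.rpow_neg hb.le]
  have hX : 0 < x ^ α := by positivity
  have hB : 0 < b ^ α := by positivity
  generalize x ^ α = X at *
  generalize b ^ α = B at *
  have h2 := mul_pos (sub_pos.2 h) (show 0 < b / (x * X) by positivity)
  have : B⁻¹ - X⁻¹ - α * (x - b) * (X⁻¹ / x) = 
    (x * X / (b * B) - (1 + (1 + α) * (x / b - 1))) * (b / (x * X)) := by
    field_simp
    ring
  rw [this]; exact h2

theorem aux_L1 (α a b : ℝ) (hα0 : 0 < α) (hα1 : α < 1) (ha : 0 ≤ a) (hab : a < b) :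
    (1 - α) * b ^ (-α) * (b - a) < b ^ (1 - α) - a ^ (1 - α) := by
  have hb : 0 < b := ha.trans_lt hab
  have h := rpow_one_add_lt_one_add_mul_self (s := a / b - 1) (p := 1 - α)
    (by have : 0 ≤ a / b := by positivity
        linarith) (by
      have : a / b < 1 := by rwa [div_lt_one hb]
      linarith) (by linarith) (by linarith)
  rw [add_sub_cancel, Real.div_rpow ha hb.le] at h
  have e : b ^ (1 - α) = b * b ^ (-α) := by
    rw [sub_eq_add_neg, Real.rpow_add hb, Real.rpow_one]
  rw [e] at h ⊢
  have hB : 0 < b ^ (-α) := by positivity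
  generalize b ^ (-α) = B at *
  rw [div_lt_iff₀ (by positivity)] at h
  have : (1 + (1 - α) * (a / b - 1)) * (b * B) = b * B + (1 - α) * (a - b) * B := by
    field_simp
  rw [this] at h
  linarith

theorem aux_L2 (α b c : ℝ) (hα0 : 0 < α) (hb : 0 < b) (hbc : b < c) :
    c ^ (1 - α) - b ^ (1 - α) < (1 - α) * (c - b) * ((b ^ (-α) + c ^ (-α)) / 2) ∨ 1 ≤ α := by
  by_cases hα1 : 1 ≤ α
  · exact Or.inr hα1
  left
  push Not at hα1
  let G : ℝ → ℝ := fun x => (1 - α) * (x - b) * ((b ^ (-α) + x ^ (-α)) / 2) - x ^ (1 - α)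
  have hd : ∀ x, 0 < x → HasDerivAt G ((1 - α) / 2 *
      (b ^ (-α) - x ^ (-α) - α * (x - b) * x ^ (-α - 1))) x := by
    intro x hx
    have h1 := Real.hasDerivAt_rpow_const (x := x) (p := -α) (Or.inl hx.ne')
    have h2 := Real.hasDerivAt_rpow_const (x := x) (p := 1 - α) (Or.inl hx.ne')
    have h3 := ((((hasDerivAt_id x).sub_const b).const_mul (1 - α)).mul
      ((h1.const_add (b ^ (-α))).div_const 2)).sub h2
    refine h3.congr_deriv ?_
    have : 1 - α - 1 = -α := by ring
    rw [this]
    simp only [id]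
    ring
  have hm : StrictMonoOn G (Set.Icc b c) := by
    apply strictMonoOn_of_deriv_pos (convex_Icc b c)
    · intro x hx
      exact (hd x (hb.trans_le hx.1)).continuousAt.continuousWithinAt
    · intro x hx
      rw [interior_Icc] at hx
      rw [(hd x (hb.trans hx.1)).deriv]
      exact mul_pos (by linarith) (aux_tangent α b x hα0 hb hx.1)
  have := hm (Set.left_mem_Icc.2 hbc.le) (Set.right_mem_Icc.2 hbc.le) hbc
  simp only [G, sub_self, mul_zero, zero_mul] at this
  linarith

/-- Monotonicity of the L1 kernels:
`A^{(n,0)}_{n-k-1} - A^{(n,0)}_{n-k} > (1/2)(ω_{1-α}(t_n - t_k) - ω_{1-α}(t_n - t_{k-1})) > 0`. -/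
theorem stmt_8 (N : ℕ) (hN : 1 ≤ N) (α T : ℝ) (hα0 : 0 < α) (hα1 : α < 1)
    (t : ℕ → ℝ) (ht0 : t 0 = 0) (htN : t N = T)
    (htmono : ∀ k : ℕ, 1 ≤ k → k ≤ N → t (k-1) < t k)
    (n : ℕ) (hn : 2 ≤ n) (hnN : n ≤ N) (k : ℕ) (hk1 : 1 ≤ k) (hkn : k ≤ n - 1) :
    (1/2) * (om (1-α) (t n - t k) - om (1-α) (t n - t (k-1)))
        < L1K α t n (k+1) - L1K α t n k ∧
      0 < (1/2) * (om (1-α) (t n - t k) - om (1-α) (t n - t (k-1))) := by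

  have step : ∀ j, 1 ≤ j → j ≤ n → t (j-1) < t j := fun j h1 h2 => htmono j h1 (h2.trans hnN)
  have hle : ∀ m, m ≤ n → ∀ j, j ≤ m → t j ≤ t m := by
    intro m
    induction m with
    | zero => intro _ j hj; simp_all
    | succ m ih =>
      intro hm j hj
      rcases Nat.lt_or_ge j (m+1) with h | h
      · exact (ih (by omega) j (by omega)).trans (by simpa using (step (m+1) (by omega) hm).le)
      · rw [show j = m + 1 by omega]
  have ha : 0 ≤ t n - t (k+1) := sub_nonneg.2 (hle n le_rfl (k+1) (by omega))
  have hab : t n - t (k+1) < t n - t k := by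
    have := step (k+1) (by omega) (by omega)
    simp only [Nat.add_sub_cancel] at this
    linarith
  have hbc : t n - t k < t n - t (k-1) := by
    have := step k hk1 (by omega)
    linarith
  have eab : t (k+1) - t k = (t n - t k) - (t n - t (k+1)) := by ring
  have ebc : t k - t (k-1) = (t n - t (k-1)) - (t n - t k) := by ring
  unfold L1K om
  simp only [Nat.add_sub_cancel]
  rw [eab, ebc]
  generalize t n - t (k+1) = a at *
  generalize t n - t k = b at *
  generalize t n - t (k-1) = c at *
  have hb : 0 < b := ha.trans_lt hab
  have hG : Real.Gamma (2 - α) = (1 - α) * Real.Gamma (1 - α) := by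
    rw [← Real.Gamma_add_one (by linarith)]; congr 1; ring
  have hg : 0 < Real.Gamma (1 - α) := Real.Gamma_pos_of_pos (by linarith)
  rw [hG, show 2 - α - 1 = 1 - α by ring, show 1 - α - 1 = -α by ring]
  generalize Real.Gamma (1 - α) = g at *
  have h1 := aux_L1 α a b hα0 hα1 ha hab
  have h2 := (aux_L2 α b c hα0 hb hbc).resolve_right (by linarith)
  have h3 : c ^ (-α) < b ^ (-α) := Real.rpow_lt_rpow_of_neg hb hbc (by linarith)
  have hs : 0 < 1 - α := by linarith
  have hba : 0 < b - a := by linarith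
  have hcb : 0 < c - b := by linarith
  constructor
  · have k1 : b ^ (-α) / g < (b ^ (1-α) / ((1-α) * g) - a ^ (1-α) / ((1-α) * g)) / (b - a) := by
      rw [← sub_div, div_div, div_lt_div_iff₀ hg (by positivity)]
      have := mul_lt_mul_of_pos_right h1 hg
      linarith
    have k2 : (c ^ (1-α) / ((1-α) * g) - b ^ (1-α) / ((1-α) * g)) / (c - b)
        < ((b ^ (-α) + c ^ (-α)) / 2) / g := by
      rw [← sub_div, div_div, div_lt_div_iff₀ (by positivity) hg]
      have := mul_lt_mul_of_pos_right h2 hg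
      linarith
    have k3 : ((b ^ (-α) + c ^ (-α)) / 2) / g = (1/2) * (b ^ (-α) / g + c ^ (-α) / g) := by ring
    linarith
  · have := div_lt_div_of_pos_right h3 hg
    linarith
end

section
/- (Local consistency of the L1 formula.) Let 0 < α < 1, σ ∈ (0,1) ∪ (1,2), and let v ∈ C²_σ((0,T]). On a mesh 0 = t_0 < ⋯ < t_N = T with steps τ_k := t_k − t_{k−1}, define the L1 kernels A^{(n,0)}_{n−k} := (ω_{2−α}(t_n − t_{k−1}) − ω_{2−α}(t_n − t_k))/τ_k and the local consistency error Υ^n[v] := (∂_t^α v)(t_n) − Σ_{k=1}^n A^{(n,0)}_{n−k} (v(t_k) − v(t_{k−1})). Then for every 1 ≤ n ≤ N: |Υ^n[v]| ≤ A^{(n,0)}_0 G^n + Σ_{k=1}^{n−1} (A^{(n,0)}_{n−k−1} − A^{(n,0)}_{n−k}) G^k, where G^k := 2 ∫_{t_{k−1}}^{t_k} (t − t_{k−1}) |v''(t)| dt. -/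
/-- Caputo fractional derivative of order α, expressed through the first derivative. -/
noncomputable def caputo (α : ℝ) (v' : ℝ → ℝ) (x : ℝ) : ℝ :=
  ∫ s in (0:ℝ)..x, ((x - s) ^ (-α) / Real.Gamma (1 - α)) * v' s

/-- `G^k := 2 ∫_{t_{k-1}}^{t_k} (s - t_{k-1}) |v''(s)| ds`. -/
noncomputable def GL1 (v'' : ℝ → ℝ) (t : ℕ → ℝ) (k : ℕ) : ℝ :=
  2 * ∫ s in (t (k-1))..(t k), (s - t (k-1)) * |v'' s|

open MeasureTheory Set in
lemma h_slope {W w : ℝ → ℝ} {a b : ℝ} (hab : a < b) (hW : ContinuousOn W (Icc a b))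
    (hd : ∀ s ∈ Ioo a b, HasDerivAt W (-(w s)) s) :
    ∃ c ∈ Ioo a b, W a - W b = w c * (b - a) := by
  obtain ⟨c, hc, h⟩ := exists_hasDerivAt_eq_slope W (fun s => -(w s)) hab hW hd
  refine ⟨c, hc, ?_⟩
  have : b - a ≠ 0 := by linarith
  field_simp at h
  linarith

open MeasureTheory Set in
lemma h_K_nonneg {W w : ℝ → ℝ} {a b : ℝ} (hab : a < b) (hW : ContinuousOn W (Icc a b))
    (hd : ∀ s ∈ Ioo a b, HasDerivAt W (-(w s)) s) (hm : MonotoneOn w (Ioo a b))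
    {y : ℝ} (hy : y ∈ Icc a b) :
    0 ≤ W y - W a + (W a - W b) / (b - a) * (y - a) := by
  rcases eq_or_lt_of_le hy.1 with rfl | h1
  · simp
  rcases eq_or_lt_of_le hy.2 with rfl | h2
  · have : y - a ≠ 0 := by linarith
    field_simp; simp
  obtain ⟨c, hc, e1⟩ := h_slope h1 (hW.mono (Icc_subset_Icc le_rfl h2.le))
    (fun s hs => hd s ⟨hs.1, hs.2.trans h2⟩)
  obtain ⟨d, hdd, e2⟩ := h_slope h2 (hW.mono (Icc_subset_Icc h1.le le_rfl))
    (fun s hs => hd s ⟨h1.trans hs.1, hs.2⟩)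
  have hcd : w c ≤ w d := hm ⟨hc.1, hc.2.trans h2⟩ ⟨h1.trans hdd.1, hdd.2⟩ (hc.2.trans hdd.1).le
  have hA : w c ≤ (W a - W b) / (b - a) := by
    rw [le_div_iff₀ (by linarith)]
    nlinarith
  nlinarith

open MeasureTheory Set in
lemma h_piece {W w v v' v'' : ℝ → ℝ} {a b M D ρ : ℝ} (hab : a < b)
    (hW : ContinuousOn W (Icc a b))
    (hd : ∀ s ∈ Ioo a b, HasDerivAt W (-(w s)) s) (hm : MonotoneOn w (Ioo a b))
    (hw0 : ∀ s ∈ Ioo a b, 0 ≤ w s) (hρ : 0 < ρ) (hρ1 : ρ < 1) (hM : 0 ≤ M)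
    (hv : ContinuousOn v (Icc a b))
    (hd1 : ∀ s ∈ Ioc a b, HasDerivAt v (v' s) s)
    (hd2 : ∀ s ∈ Ioc a b, HasDerivAt v' (v'' s) s)
    (hb1 : ∀ s ∈ Ioc a b, |v' s| ≤ M * (s - a) ^ (ρ - 1))
    (hb2 : ∀ s ∈ Ioc a b, |v'' s| ≤ M * (s - a) ^ (ρ - 2))
    (hK : ∀ y ∈ Icc a b, W y - W a + (W a - W b) / (b - a) * (y - a) ≤ D * (y - a)) :
    IntervalIntegrable (fun s => w s * v' s) volume a b ∧
    |(∫ s in a..b, w s * v' s) - (W a - W b) / (b - a) * (v b - v a)| ≤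
      D * (2 * ∫ s in a..b, (s - a) * |v'' s|) := by
  set A := (W a - W b) / (b - a) with hA
  set K : ℝ → ℝ := fun y => W y - W a + A * (y - a) with hKdef
  have hK0 : ∀ y ∈ Icc a b, 0 ≤ K y := fun y hy => h_K_nonneg hab hW hd hm hy
  have hK1 : ∀ y ∈ Icc a b, K y ≤ D * (y - a) := hK
  have hKb : K b = 0 := by
    have : b - a ≠ 0 := by linarith
    simp only [hKdef, hA]; field_simp; ring
  have hKa : K a = 0 := by simp [hKdef]
  have hD : 0 ≤ D := by
    have := hK1 b ⟨hab.le, le_rfl⟩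
    rw [hKb] at this
    exact nonneg_of_mul_nonneg_left this (by linarith)
  have hKc : ContinuousOn K (Icc a b) := by
    simp only [hKdef]; fun_prop
  have hv'c : ContinuousOn v' (Ioc a b) := fun s hs => (hd2 s hs).continuousAt.continuousWithinAt
  -- integrability of the weight
  have hpow : IntervalIntegrable (fun s => (s - a) ^ (ρ - 1)) volume a b := by
    have := (intervalIntegral.intervalIntegrable_rpow' (a := 0) (b := b - a)
      (r := ρ - 1) (by linarith)).comp_sub_right a
    simpa using this
  have hmono : ∀ {f g : ℝ → ℝ}, AEStronglyMeasurable f (volume.restrict (Ioc a b)) →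
      IntervalIntegrable g volume a b → (∀ s ∈ Ioo a b, |f s| ≤ g s) →
      IntervalIntegrable f volume a b := by
    intro f g hf hg hfg
    rw [intervalIntegrable_iff_integrableOn_Ioc_of_le hab.le] at hg ⊢
    refine Integrable.mono' hg hf ?_
    rw [← restrict_Ioo_eq_restrict_Ioc]
    filter_upwards [ae_restrict_mem measurableSet_Ioo] with s hs using hfg s hs
  have hv'm : AEStronglyMeasurable v' (volume.restrict (Ioc a b)) :=
    hv'c.aestronglyMeasurable measurableSet_Ioc
  have hv''m : AEStronglyMeasurable v'' (volume.restrict (Ioc a b)) := by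
    refine (measurable_deriv v').aestronglyMeasurable.congr ?_
    filter_upwards [ae_restrict_mem measurableSet_Ioc] with s hs using (hd2 s hs).deriv
  have hKm : AEStronglyMeasurable K (volume.restrict (Ioc a b)) :=
    (hKc.mono Ioc_subset_Icc_self).aestronglyMeasurable measurableSet_Ioc
  have hwint : IntervalIntegrable w volume a b := by
    refine intervalIntegral.intervalIntegrable_deriv_of_nonneg (g := fun s => - W s) ?_ ?_ ?_
    · rw [uIcc_of_le hab.le]; exact hW.neg
    · rw [min_eq_left hab.le, max_eq_right hab.le]
      intro s hs; exact (hd s hs).neg.congr_deriv (neg_neg _)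
    · rw [min_eq_left hab.le, max_eq_right hab.le]
      exact hw0
  have hwm : AEStronglyMeasurable w (volume.restrict (Ioc a b)) := hwint.1.aestronglyMeasurable
  have hv'int : IntervalIntegrable v' volume a b :=
    hmono hv'm (hpow.const_mul M) (fun s hs => hb1 s ⟨hs.1, hs.2.le⟩)
  have hpow2 : ∀ s ∈ Ioc a b, (s - a) * |v'' s| ≤ M * (s - a) ^ (ρ - 1) := by
    intro s hs
    have hs0 : 0 < s - a := by linarith [hs.1]
    have e : (s - a) ^ (ρ - 1) = (s - a) * (s - a) ^ (ρ - 2) := by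
      rw [← Real.rpow_one_add' hs0.le (by linarith)]; ring_nf
    rw [e]
    calc _ ≤ (s - a) * (M * (s - a) ^ (ρ - 2)) := by gcongr; exact hb2 s hs
      _ = _ := by ring
  have hGint : IntervalIntegrable (fun s => (s - a) * |v'' s|) volume a b := by
    refine hmono ?_ (hpow.const_mul M) (fun s hs => ?_)
    · exact (by fun_prop : Continuous fun s : ℝ => s - a).aestronglyMeasurable.mul
        (continuous_abs.comp_aestronglyMeasurable hv''m)
    · rw [abs_of_nonneg (mul_nonneg (by linarith [hs.1]) (abs_nonneg _))]
      exact hpow2 s ⟨hs.1, hs.2.le⟩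
  have hKv : ∀ s ∈ Ioc a b, |K s * v'' s| ≤ D * ((s - a) * |v'' s|) := by
    intro s hs
    have hs' : s ∈ Icc a b := ⟨hs.1.le, hs.2⟩
    rw [abs_mul, abs_of_nonneg (hK0 s hs'), ← mul_assoc]
    exact mul_le_mul_of_nonneg_right (hK1 s hs') (abs_nonneg _)
  have hKint : IntervalIntegrable (fun s => K s * v'' s) volume a b :=
    hmono (hKm.mul hv''m) (hGint.const_mul D) (fun s hs => hKv s ⟨hs.1, hs.2.le⟩)
  have hwv : IntervalIntegrable (fun s => w s * v' s) volume a b := by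
    set m := (a + b) / 2 with hmdef
    have hm1 : a < m := by rw [hmdef]; linarith
    have hm2 : m < b := by rw [hmdef]; linarith
    refine hmono (hwm.mul hv'm)
      ((hpow.const_mul (w m * M)).add (hwint.const_mul (M * (m - a) ^ (ρ - 1)))) (fun s hs => ?_)
    have hs0 : 0 < s - a := by linarith [hs.1]
    have hp : 0 ≤ (s - a) ^ (ρ - 1) := Real.rpow_nonneg hs0.le _
    have hpm : 0 ≤ (m - a) ^ (ρ - 1) := Real.rpow_nonneg (by linarith) _
    have hws := hw0 s hs
    have hwm' := hw0 m ⟨hm1, hm2⟩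
    have hbs := hb1 s ⟨hs.1, hs.2.le⟩
    rw [abs_mul, abs_of_nonneg hws]
    have h1 : w s * |v' s| ≤ w s * (M * (s - a) ^ (ρ - 1)) := by gcongr
    rcases le_total s m with h | h
    · have := hm hs ⟨hm1, hm2⟩ h
      have h2 : w s * (M * (s - a) ^ (ρ - 1)) ≤ w m * (M * (s - a) ^ (ρ - 1)) := by gcongr
      have h3 : 0 ≤ M * (m - a) ^ (ρ - 1) * w s := by positivity
      linarith
    · have : (s - a) ^ (ρ - 1) ≤ (m - a) ^ (ρ - 1) :=
        Real.rpow_le_rpow_of_nonpos (by linarith) (by linarith) (by linarith)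
      have h2 : w s * (M * (s - a) ^ (ρ - 1)) ≤ w s * (M * (m - a) ^ (ρ - 1)) := by gcongr
      have h3 : 0 ≤ w m * M * (s - a) ^ (ρ - 1) := by positivity
      linarith
  refine ⟨hwv, ?_⟩
  have hFc : ContinuousOn (fun y => K y * v' y) (Icc a b) := by
    intro y hy
    rcases eq_or_lt_of_le hy.1 with rfl | h1
    · have hz : Filter.Tendsto (fun y => D * M * (y - a) ^ ρ) (nhdsWithin a (Icc a b)) (nhds 0) := by
        have : Continuous fun y : ℝ => D * M * (y - a) ^ ρ := by
          have : Continuous fun y : ℝ => (y - a) ^ ρ :=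
            (by fun_prop : Continuous fun y : ℝ => y - a).rpow_const (fun _ => Or.inr hρ.le)
          fun_prop
        have h2 := (this.tendsto a).mono_left (nhdsWithin_le_nhds (s := Icc a b))
        simpa [Real.zero_rpow hρ.ne'] using h2
      show Filter.Tendsto _ _ _
      simp only [hKa, zero_mul]
      refine squeeze_zero_norm' ?_ hz
      filter_upwards [self_mem_nhdsWithin] with s hs
      rcases eq_or_lt_of_le hs.1 with rfl | h3
      · simp [hKa, Real.zero_rpow hρ.ne']
      · have hs0 : 0 < s - a := by linarith
        have e : (s - a) ^ ρ = (s - a) * (s - a) ^ (ρ - 1) := by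
          rw [← Real.rpow_one_add' hs0.le (by linarith)]; ring_nf
        rw [Real.norm_eq_abs, abs_mul, abs_of_nonneg (hK0 s hs), e]
        calc _ ≤ (D * (s - a)) * (M * (s - a) ^ (ρ - 1)) :=
              mul_le_mul (hK1 s hs) (hb1 s ⟨h3, hs.2⟩) (abs_nonneg _) (by positivity)
          _ = _ := by ring
    · exact (hKc y hy).mul (hd2 y ⟨h1, hy.2⟩).continuousAt.continuousWithinAt
  have hFd : ∀ y ∈ Ioo a b, HasDerivAt (fun y => K y * v' y)
      ((A * v' y - w y * v' y) + K y * v'' y) y := by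
    intro y hy
    have h1 : HasDerivAt K (-(w y) + A) y := by
      have := ((hd y hy).sub_const (W a)).add (((hasDerivAt_id y).sub_const a).const_mul A)
      exact this.congr_deriv (by simp)
    have := h1.mul (hd2 y ⟨hy.1, hy.2.le⟩)
    exact this.congr_deriv (by ring)
  have hI := intervalIntegral.integral_eq_sub_of_hasDerivAt_of_le hab.le hFc hFd
    (((hv'int.const_mul A).sub hwv).add hKint)
  have hIv := intervalIntegral.integral_eq_sub_of_hasDerivAt_of_le hab.le hv
    (fun x hx => hd1 x ⟨hx.1, hx.2.le⟩) hv'int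
  rw [intervalIntegral.integral_add ((hv'int.const_mul A).sub hwv) hKint,
    intervalIntegral.integral_sub (hv'int.const_mul A) hwv,
    intervalIntegral.integral_const_mul, hIv, hKa, hKb] at hI
  have hfin : (∫ s in a..b, w s * v' s) - A * (v b - v a) = ∫ s in a..b, K s * v'' s := by
    linarith
  rw [hfin]
  have hle := intervalIntegral.norm_integral_le_of_norm_le (f := fun s => K s * v'' s) hab.le
    (Filter.Eventually.of_forall (fun s hs => hKv s hs)) (hGint.const_mul D)
  rw [intervalIntegral.integral_const_mul, Real.norm_eq_abs] at hle
  have hG0 : 0 ≤ ∫ s in a..b, (s - a) * |v'' s| :=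
    intervalIntegral.integral_nonneg hab.le
      (fun s hs => mul_nonneg (by linarith [hs.1]) (abs_nonneg _))
  have := mul_nonneg hD hG0
  linarith

lemma h_conv {α x y p q : ℝ} (hα : 0 < α) (hx : 0 < x) (hy : 0 < y) (hp : 0 ≤ p) (hq : 0 ≤ q)
    (hpq : p + q = 1) : (p * x + q * y) ^ (-α) ≤ p * x ^ (-α) + q * y ^ (-α) := by
  have h1 := Real.geom_mean_le_arith_mean2_weighted hp hq hx.le hy.le hpq
  have h2 := Real.geom_mean_le_arith_mean2_weighted hp hq (Real.rpow_nonneg hx.le (-α))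
    (Real.rpow_nonneg hy.le (-α)) hpq
  refine le_trans ?_ h2
  have h3 : 0 < x ^ p * y ^ q := by positivity
  refine (Real.rpow_le_rpow_of_nonpos h3 h1 (by linarith)).trans (le_of_eq ?_)
  rw [Real.mul_rpow (by positivity) (by positivity), ← Real.rpow_mul hx.le, ← Real.rpow_mul hy.le,
    ← Real.rpow_mul hx.le, ← Real.rpow_mul hy.le, mul_comm p, mul_comm q]

open Set in
lemma h_trap {W w : ℝ → ℝ} {a b : ℝ} (hab : a < b) (hW : ContinuousOn W (Icc a b))
    (hd : ∀ s ∈ Ioo a b, HasDerivAt W (-(w s)) s)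
    (hc : ∀ s ∈ Ioo a b, w s ≤ w a + (w b - w a) / (b - a) * (s - a)) :
    (W a - W b) / (b - a) ≤ (w a + w b) / 2 := by
  set S := (w b - w a) / (b - a) with hS
  have hSb : S * (b - a) = w b - w a := by
    have : b - a ≠ 0 := by linarith
    rw [hS]; field_simp
  obtain ⟨c, hcm, h⟩ := h_slope (W := fun s => W s + w a * (s - a) + S * (s - a) ^ 2 / 2)
    (w := fun s => w s - (w a + S * (s - a))) hab (by fun_prop) (by
      intro s hs
      have h1 := (hasDerivAt_id s).sub_const a
      have := ((hd s hs).add (h1.const_mul (w a))).add (((h1.pow 2).const_mul S).div_const 2)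
      exact this.congr_deriv (by simp; ring))
  have := hc c hcm
  rw [div_le_iff₀ (by linarith)]
  have h2 : (w c - (w a + S * (c - a))) * (b - a) ≤ 0 :=
    mul_nonpos_of_nonpos_of_nonneg (by linarith) (by linarith)
  nlinarith

lemma h_pow {s T p q : ℝ} (hs : 0 < s) (hsT : s ≤ T) (hq : 0 ≤ q) (hpq : 0 ≤ p + q) :
    1 + s ^ p ≤ (T ^ q + T ^ (p + q)) * s ^ (-q) := by
  have h1 : s ^ q ≤ T ^ q := Real.rpow_le_rpow hs.le hsT hq
  have h2 : s ^ (p + q) ≤ T ^ (p + q) := Real.rpow_le_rpow hs.le hsT hpq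
  have h3 : 0 < s ^ (-q) := Real.rpow_pos_of_pos hs _
  have e1 : (1:ℝ) = s ^ q * s ^ (-q) := by rw [← Real.rpow_add hs]; simp
  have e2 : s ^ p = s ^ (p + q) * s ^ (-q) := by rw [← Real.rpow_add hs]; simp
  rw [e2]; nth_rewrite 1 [e1]
  rw [← add_mul]; gcongr

open Set in
lemma h_W (α x : ℝ) (hα0 : 0 < α) (hα1 : α < 1) :
    Continuous (fun s => om (2 - α) (x - s)) ∧
    (∀ s < x, HasDerivAt (fun s => om (2 - α) (x - s))
      (-((x - s) ^ (-α) / Real.Gamma (1 - α))) s) ∧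
    (MonotoneOn (fun s => (x - s) ^ (-α) / Real.Gamma (1 - α)) (Iio x)) ∧
    (∀ s < x, 0 ≤ (x - s) ^ (-α) / Real.Gamma (1 - α)) := by
  have hG : 0 < Real.Gamma (1 - α) := Real.Gamma_pos_of_pos (by linarith)
  have hG2 : Real.Gamma (2 - α) = (1 - α) * Real.Gamma (1 - α) := by
    rw [← Real.Gamma_add_one (by linarith)]; ring_nf
  have h1α : (1 - α) ≠ 0 := by linarith
  refine ⟨?_, ?_, ?_, ?_⟩
  · unfold om
    exact ((by fun_prop : Continuous fun s : ℝ => x - s).rpow_const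
      (fun _ => Or.inr (by linarith))).div_const _
  · intro s hs
    unfold om
    have h1 := ((hasDerivAt_id s).const_sub x).rpow_const (p := 2 - α - 1)
      (Or.inl (by simp; linarith))
    refine (h1.div_const (Real.Gamma (2 - α))).congr_deriv ?_
    rw [hG2, show 2 - α - 1 - 1 = -α by ring]
    simp only [id]
    field_simp
    ring
  · intro s hs r hr hsr
    simp only [mem_Iio] at hs hr
    simp only
    gcongr ?_ / _
    exact Real.rpow_le_rpow_of_nonpos (by linarith) (by linarith) (by linarith)
  · intro s hs
    have := Real.rpow_nonneg (by linarith : 0 ≤ x - s) (-α)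
    positivity

theorem stmt_9 (α σ T Cv : ℝ) (hα0 : 0 < α) (hα1 : α < 1)
    (hσ : (0 < σ ∧ σ < 1) ∨ (1 < σ ∧ σ < 2)) (hT : 0 < T) (hCv : 0 < Cv)
    (v v' v'' : ℝ → ℝ)
    (hvc : ContinuousOn v (Set.Icc 0 T))
    (hd1 : ∀ s ∈ Set.Ioc (0:ℝ) T, HasDerivAt v (v' s) s)
    (hd2 : ∀ s ∈ Set.Ioc (0:ℝ) T, HasDerivAt v' (v'' s) s)
    (hb1 : ∀ s ∈ Set.Ioc (0:ℝ) T, |v' s| ≤ Cv * (1 + s ^ (σ - 1)))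
    (hb2 : ∀ s ∈ Set.Ioc (0:ℝ) T, |v'' s| ≤ Cv * (1 + s ^ (σ - 2)))
    (N : ℕ) (hN : 1 ≤ N) (t : ℕ → ℝ) (ht0 : t 0 = 0) (htN : t N = T)
    (htmono : ∀ k : ℕ, 1 ≤ k → k ≤ N → t (k-1) < t k)
    (n : ℕ) (hn1 : 1 ≤ n) (hnN : n ≤ N) :
    |caputo α v' (t n)
        - ∑ k ∈ Finset.Icc 1 n, L1K α t n k * (v (t k) - v (t (k-1)))|
      ≤ L1K α t n n * GL1 v'' t n
        + ∑ k ∈ Finset.Icc 1 (n-1), (L1K α t n (k+1) - L1K α t n k) * GL1 v'' t k := by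
  
  obtain ⟨hWc, hWd, hwm, hw0⟩ := h_W α (t n) hα0 hα1
  set x := t n with hx
  set W : ℝ → ℝ := fun s => om (2 - α) (x - s) with hWdef
  set w : ℝ → ℝ := fun s => (x - s) ^ (-α) / Real.Gamma (1 - α) with hwdef
  have hG : 0 < Real.Gamma (1 - α) := Real.Gamma_pos_of_pos (by linarith)
  have hmon : ∀ i j : ℕ, i ≤ j → j ≤ N → t i ≤ t j := by
    intro i j hij
    induction j, hij using Nat.le_induction with
    | base => intro _; exact le_rfl
    | succ j hj ih =>
      intro h
      have := htmono (j+1) (by omega) h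
      simp only [Nat.add_sub_cancel] at this
      exact (ih (by omega)).trans this.le
  have hst : ∀ k : ℕ, k < N → t k < t (k+1) := by
    intro k hk
    simpa using htmono (k+1) (by omega) (by omega)
  have hσ0 : 0 < σ := by rcases hσ with h | h <;> linarith
  obtain ⟨ρ, hρ0, hρ1, hρσ⟩ : ∃ ρ : ℝ, 0 < ρ ∧ ρ < 1 ∧ ρ ≤ σ :=
    ⟨min σ (1/2), by positivity, (min_le_right _ _).trans_lt (by norm_num), min_le_left _ _⟩
  set M1 := T ^ (1 - ρ) + T ^ (σ - 1 + (1 - ρ))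
  set M2 := T ^ (2 - ρ) + T ^ (σ - 2 + (2 - ρ))
  have hM1 : 0 ≤ M1 := by positivity
  have hM2 : 0 ≤ M2 := by positivity
  set M := Cv * (M1 + M2)
  have hM : 0 ≤ M := by positivity
  have hB1 : ∀ s ∈ Set.Ioc (0:ℝ) T, |v' s| ≤ M * s ^ (ρ - 1) := by
    intro s hs
    have h1 := h_pow (p := σ - 1) (q := 1 - ρ) hs.1 hs.2 (by linarith) (by linarith)
    have h2 : 0 < s ^ (ρ - 1) := Real.rpow_pos_of_pos hs.1 _
    rw [neg_sub] at h1
    calc _ ≤ _ := hb1 s hs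
      _ ≤ Cv * (M1 * s ^ (ρ - 1)) := by gcongr
      _ ≤ Cv * ((M1 + M2) * s ^ (ρ - 1)) := by gcongr; linarith
      _ = _ := by ring
  have hB2 : ∀ s ∈ Set.Ioc (0:ℝ) T, |v'' s| ≤ M * s ^ (ρ - 2) := by
    intro s hs
    have h1 := h_pow (p := σ - 2) (q := 2 - ρ) hs.1 hs.2 (by linarith) (by linarith)
    have h2 : 0 < s ^ (ρ - 2) := Real.rpow_pos_of_pos hs.1 _
    rw [neg_sub] at h1
    calc _ ≤ _ := hb2 s hs
      _ ≤ Cv * (M2 * s ^ (ρ - 2)) := by gcongr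
      _ ≤ Cv * ((M1 + M2) * s ^ (ρ - 2)) := by gcongr; linarith
      _ = _ := by ring
  -- one subinterval
  have hpiece : ∀ (k : ℕ) (D : ℝ), k < n →
      (∀ y ∈ Set.Icc (t k) (t (k+1)), W y - W (t k) +
        (W (t k) - W (t (k+1))) / (t (k+1) - t k) * (y - t k) ≤ D * (y - t k)) →
      IntervalIntegrable (fun s => w s * v' s) MeasureTheory.volume (t k) (t (k+1)) ∧
      |(∫ s in (t k)..(t (k+1)), w s * v' s) - L1K α t n (k+1) * (v (t (k+1)) - v (t k))|
        ≤ D * GL1 v'' t (k+1) := by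
    intro k D hk hKD
    have h0 : 0 ≤ t k := ht0 ▸ hmon 0 k (by omega) (by omega)
    have h1 : t (k+1) ≤ T := htN ▸ hmon (k+1) N (by omega) le_rfl
    have h2 : t (k+1) ≤ x := hmon (k+1) n (by omega) (by omega)
    have hsub : ∀ s ∈ Set.Ioc (t k) (t (k+1)), s ∈ Set.Ioc 0 T :=
      fun s hs => ⟨h0.trans_lt hs.1, hs.2.trans h1⟩
    exact h_piece (hst k (by omega)) hWc.continuousOn
      (fun s hs => hWd s (hs.2.trans_le h2)) (hwm.mono fun s hs => hs.2.trans_le h2)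
      (fun s hs => hw0 s (hs.2.trans_le h2)) hρ0 hρ1 hM
      (hvc.mono (Set.Icc_subset_Icc h0 h1)) (fun s hs => hd1 s (hsub s hs))
      (fun s hs => hd2 s (hsub s hs))
      (fun s hs => (hB1 s (hsub s hs)).trans (mul_le_mul_of_nonneg_left
        (Real.rpow_le_rpow_of_nonpos (by linarith [hs.1]) (by linarith) (by linarith)) hM))
      (fun s hs => (hB2 s (hsub s hs)).trans (mul_le_mul_of_nonneg_left
        (Real.rpow_le_rpow_of_nonpos (by linarith [hs.1]) (by linarith) (by linarith)) hM))
      hKD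
  obtain ⟨m, rfl⟩ : ∃ m, n = m + 1 := ⟨n - 1, by omega⟩
  -- last subinterval
  have hlast := hpiece m (L1K α t (m+1) (m+1)) (by omega) (by
    intro y hy
    obtain hh | hh := eq_or_lt_of_le hy.1
    · simp [← hh]
    have hWy : W y ≤ W (t m) := by
      obtain ⟨c, hc, h⟩ := h_slope hh hWc.continuousOn (fun s hs => hWd s (hs.2.trans_le hy.2))
      have := mul_nonneg (hw0 c (hc.2.trans_le hy.2)) (by linarith : 0 ≤ y - t m)
      linarith
    have e : L1K α t (m+1) (m+1) = (W (t m) - W (t (m+1))) / (t (m+1) - t m) := rfl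
    rw [e]; linarith)
  -- earlier subintervals
  have hearly : ∀ k < m, _ := fun k hk =>
    hpiece k (L1K α t (m+1) (k+1+1) - L1K α t (m+1) (k+1)) (by omega) (by
    intro y hy
    obtain hh | hh := eq_or_lt_of_le hy.1
    · simp [← hh]
    have hab := hst k (by omega)
    have hbc := hst (k+1) (by omega)
    have hbx : t (k+1+1) ≤ x := hmon (k+1+1) (m+1) (by omega) (by omega)
    have hbx' : t (k+1) < x := hbc.trans_le hbx
    have e1 : L1K α t (m+1) (k+1) = (W (t k) - W (t (k+1))) / (t (k+1) - t k) := rfl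
    have e2 : L1K α t (m+1) (k+1+1) =
      (W (t (k+1)) - W (t (k+1+1))) / (t (k+1+1) - t (k+1)) := rfl
    have hA2 : w (t (k+1)) ≤ L1K α t (m+1) (k+1+1) := by
      obtain ⟨c, hc, h⟩ := h_slope hbc hWc.continuousOn (fun s hs => hWd s (hs.2.trans_le hbx))
      rw [e2, le_div_iff₀ (by linarith), h]
      have : w (t (k+1)) ≤ w c := hwm hbx' (hc.2.trans_le hbx) hc.1.le
      exact mul_le_mul_of_nonneg_right this (by linarith)
    have hA1 : L1K α t (m+1) (k+1) ≤ (w (t k) + w (t (k+1))) / 2 := by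
      rw [e1]
      refine h_trap hab hWc.continuousOn (fun s hs => hWd s (hs.2.trans hbx')) ?_
      intro s hs
      have hd0 : t (k+1) - t k ≠ 0 := by linarith
      have hd0' : 0 < t (k+1) - t k := by linarith
      have h := h_conv (α := α) (x := x - t k) (y := x - t (k+1))
        (p := (t (k+1) - s) / (t (k+1) - t k)) (q := (s - t k) / (t (k+1) - t k)) hα0
        (by linarith) (by linarith) (div_nonneg (by linarith [hs.2]) hd0'.le)
        (div_nonneg (by linarith [hs.1]) hd0'.le) (by field_simp; ring)
      have e3 : (t (k+1) - s) / (t (k+1) - t k) * (x - t k) +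
        (s - t k) / (t (k+1) - t k) * (x - t (k+1)) = x - s := by field_simp; ring
      rw [e3] at h
      have h' := div_le_div_of_nonneg_right h hG.le
      refine h'.trans (le_of_eq ?_)
      simp only [hwdef]
      field_simp
      ring
    have hWy : w (t k) * (y - t k) ≤ W (t k) - W y := by
      have hyx : y < x := hy.2.trans_lt hbx'
      obtain ⟨c, hc, h⟩ := h_slope hh hWc.continuousOn (fun s hs => hWd s (hs.2.trans hyx))
      rw [h]
      have : w (t k) ≤ w c := hwm (hh.trans hyx) (hc.2.trans hyx) hc.1.le
      exact mul_le_mul_of_nonneg_right this (by linarith)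
    rw [← e1]
    have hfin : L1K α t (m+1) (k+1) - w (t k) ≤
      L1K α t (m+1) (k+1+1) - L1K α t (m+1) (k+1) := by linarith
    have := mul_le_mul_of_nonneg_right hfin (by linarith : 0 ≤ y - t k)
    linarith)
  have hint : ∀ k < m + 1,
      IntervalIntegrable (fun s => w s * v' s) MeasureTheory.volume (t k) (t (k+1)) := by
    intro k hk
    rcases Nat.lt_succ_iff_lt_or_eq.mp hk with h | rfl
    · exact (hearly k h).1
    · exact hlast.1
  have hcap : caputo α v' x = ∑ k ∈ Finset.range (m+1), ∫ s in (t k)..(t (k+1)), w s * v' s := by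
    rw [intervalIntegral.sum_integral_adjacent_intervals hint, ht0]; rfl
  have hs : ∀ (f : ℕ → ℝ) (j : ℕ), ∑ k ∈ Finset.Icc 1 j, f k = ∑ k ∈ Finset.range j, f (k+1) := by
    intro f j
    rw [Finset.range_eq_Ico, Finset.sum_Ico_add' f 0 j 1]
    rfl
  rw [hs, hs, hcap, ← Finset.sum_sub_distrib]
  simp only [Nat.add_sub_cancel]
  refine (Finset.abs_sum_le_sum_abs _ _).trans ?_
  rw [Finset.sum_range_succ, add_comm]
  refine add_le_add hlast.2 (Finset.sum_le_sum fun k hk => ?_)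
  exact (hearly k (Finset.mem_range.mp hk)).2
end

section
/- (Squared-sum transfer for convolution-structured consistency errors.) Let 0 < α < 1 and let 0 = t_0 < ⋯ < t_N = T be a mesh with nondecreasing steps, i.e. ρ_k := τ_k/τ_{k+1} ≤ 1 for 1 ≤ k ≤ N−1. Let A^{(n,0)}_{n−k} := (ω_{2−α}(t_n − t_{k−1}) − ω_{2−α}(t_n − t_k))/τ_k be the L1 kernels and P^{(n,0)}_{n−j} the associated complementary kernels. Suppose (G^k)_{k=1}^N is a nonnegative sequence and (Υ^j)_{j=1}^N are real numbers with |Υ^j| ≤ A^{(j,0)}_0 G^j + Σ_{k=1}^{j−1} (A^{(j,0)}_{j−k−1} − A^{(j,0)}_{j−k}) G^k for each j. Then for all 1 ≤ n ≤ N: Σ_{j=1}^n P^{(n,0)}_{n−j} |Υ^j|² ≤ 2 Σ_{j=1}^n P^{(n,0)}_{n−j} (A^{(j,0)}_0 G^j)² + 2 Σ_{k=1}^{n−1} P^{(n,0)}_{n−k} (A^{(k,0)}_0 G^k)². -/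
theorem aux_om_concave (α : ℝ) (hα0 : 0 < α) (hα1 : α < 1) :
    ConcaveOn ℝ (Set.Ici 0) (om (2 - α)) := by
  have h := (Real.concaveOn_rpow (p := 2 - α - 1) (by linarith) (by linarith)).smul
    (c := (Real.Gamma (2 - α))⁻¹) (inv_nonneg.2 (Real.Gamma_pos_of_pos (by linarith)).le)
  refine h.congr ?_
  intro x _
  simp [om, div_eq_inv_mul]

theorem aux_diag (α : ℝ) (hα1 : α < 1) (t : ℕ → ℝ) (k : ℕ) (h : t (k-1) < t k) :
    L1K α t k k = (t k - t (k-1)) ^ (-α) / Real.Gamma (2 - α) := by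
  have hp : 0 < t k - t (k-1) := sub_pos.2 h
  have e : (2 - α - 1 : ℝ) = -α + 1 := by ring
  unfold L1K om
  rw [sub_self, Real.zero_rpow (by linarith), e, Real.rpow_add hp, Real.rpow_one]
  field_simp
  simp

theorem aux_tele (f : ℕ → ℝ) (m : ℕ) :
    ∑ k ∈ Finset.Icc 1 m, (f (k+1) - f k) = f (m+1) - f 1 := by
  induction m with
  | zero => simp
  | succ m ih => rw [Finset.sum_Icc_succ_top (by omega), ih]; ring

/-- Squared-sum transfer for convolution-structured consistency errors. -/
theorem stmt_11 (N : ℕ) (hN : 1 ≤ N) (α T : ℝ) (hα0 : 0 < α) (hα1 : α < 1)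
    (t : ℕ → ℝ) (ht0 : t 0 = 0) (htN : t N = T)
    (htmono : ∀ k : ℕ, 1 ≤ k → k ≤ N → t (k-1) < t k)
    (hρ : ∀ k : ℕ, 1 ≤ k → k ≤ N - 1 → (t k - t (k-1)) / (t (k+1) - t k) ≤ 1)
    (P : ℕ → ℕ → ℝ)
    (hP0 : ∀ n : ℕ, 1 ≤ n → n ≤ N → P n 0 = 1 / L1K α t n n)
    (hPrec : ∀ n j : ℕ, 1 ≤ j → j + 1 ≤ n → n ≤ N →
      P n (n-j) = (1 / L1K α t j j) *
        ∑ k ∈ Finset.Icc (j+1) n, (L1K α t k (j+1) - L1K α t k j) * P n (n-k))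
    (G Υ : ℕ → ℝ) (hG : ∀ k : ℕ, 1 ≤ k → k ≤ N → 0 ≤ G k)
    (hΥ : ∀ j : ℕ, 1 ≤ j → j ≤ N →
      |Υ j| ≤ L1K α t j j * G j
        + ∑ k ∈ Finset.Icc 1 (j-1), (L1K α t j (k+1) - L1K α t j k) * G k)
    (n : ℕ) (hn1 : 1 ≤ n) (hnN : n ≤ N) :
    ∑ j ∈ Finset.Icc 1 n, P n (n-j) * (Υ j)^2
      ≤ 2 * ∑ j ∈ Finset.Icc 1 n, P n (n-j) * (L1K α t j j * G j)^2
        + 2 * ∑ k ∈ Finset.Icc 1 (n-1), P n (n-k) * (L1K α t k k * G k)^2 := by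
  have hlt : ∀ j i : ℕ, i < j → j ≤ N → t i < t j := by
    intro j
    induction j with
    | zero => intro i hi; omega
    | succ j ih =>
      intro i hi hj
      have h1 := htmono (j+1) (by omega) hj
      simp only [Nat.add_sub_cancel] at h1
      rcases Nat.lt_succ_iff_lt_or_eq.1 hi with h | h
      · exact (ih i h (by omega)).trans h1
      · rw [h]; exact h1
  have hle : ∀ j i : ℕ, i ≤ j → j ≤ N → t i ≤ t j := by
    intro j i hi hj
    rcases hi.lt_or_eq with h | h
    · exact (hlt j i h hj).le
    · rw [h]
  have hΓ : 0 < Real.Gamma (2 - α) := Real.Gamma_pos_of_pos (by linarith)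
  have hconc := aux_om_concave α hα0 hα1
  have hapos : ∀ k, 1 ≤ k → k ≤ N → 0 < L1K α t k k := by
    intro k h1 h2
    rw [aux_diag α hα1 t k (htmono k h1 h2)]
    exact div_pos (Real.rpow_pos_of_pos (sub_pos.2 (htmono k h1 h2)) _) hΓ
  have hd : ∀ j k, 1 ≤ k → k + 1 ≤ j → j ≤ N → 0 ≤ L1K α t j (k+1) - L1K α t j k := by
    intro j k h1 h2 h3
    have a1 := htmono k h1 (by omega)
    have a2 := hlt (k+1) k (by omega) (by omega)
    have a3 := hle j (k+1) h2 h3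
    have := hconc.slope_anti_adjacent (x := t j - t (k+1)) (y := t j - t k)
      (z := t j - t (k-1)) (by simp only [Set.mem_Ici]; linarith)
      (by simp only [Set.mem_Ici]; linarith) (by linarith) (by linarith)
    rw [sub_nonneg]
    unfold L1K
    simp only [Nat.add_sub_cancel]
    rw [sub_sub_sub_cancel_left, sub_sub_sub_cancel_left] at this
    exact this
  have hstep : ∀ k, 1 ≤ k → k + 1 ≤ N → L1K α t (k+1) (k+1) ≤ L1K α t k k := by
    intro k h1 h2
    have a1 := htmono k h1 (by omega)
    have a2 := htmono (k+1) (by omega) h2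
    rw [aux_diag α hα1 t k a1, aux_diag α hα1 t (k+1) a2]
    simp only [Nat.add_sub_cancel] at a2 ⊢
    have h := hρ k h1 (by omega)
    rw [div_le_one (sub_pos.2 a2)] at h
    exact div_le_div_of_nonneg_right
      (Real.rpow_le_rpow_of_nonpos (sub_pos.2 a1) h (by linarith)) hΓ.le
  have hanti : ∀ j k, 1 ≤ k → k ≤ j → j ≤ N → L1K α t j j ≤ L1K α t k k := by
    intro j k h1 h2
    induction j, h2 using Nat.le_induction with
    | base => intro _; exact le_rfl
    | succ j hj ih => intro h3; exact (hstep j (by omega) h3).trans (ih (by omega))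
  have hA1 : ∀ j, 1 ≤ j → j ≤ N → 0 ≤ L1K α t j 1 := by
    intro j h1 h2
    have a1 := htmono 1 le_rfl (by omega)
    have a3 := hle j 1 h1 h2
    unfold L1K om
    apply div_nonneg _ (by linarith)
    rw [sub_nonneg]
    exact div_le_div_of_nonneg_right
      (Real.rpow_le_rpow (by linarith) (by linarith) (by linarith)) hΓ.le
  have hP : ∀ m, ∀ j, n - j = m → 1 ≤ j → j ≤ n → 0 ≤ P n (n-j) := by
    intro m
    induction m using Nat.strong_induction_on with
    | _ m ih =>
      intro j hm h1 h2
      rcases h2.lt_or_eq with h | h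
      · rw [hPrec n j h1 h hnN]
        apply mul_nonneg (one_div_nonneg.2 (hapos j h1 (by omega)).le)
        apply Finset.sum_nonneg
        intro k hk
        rw [Finset.mem_Icc] at hk
        exact mul_nonneg (hd k j h1 hk.1 (by omega))
          (ih (n-k) (by omega) k rfl (by omega) hk.2)
      · subst h
        rw [Nat.sub_self, hP0 j h1 hnN]
        exact one_div_nonneg.2 (hapos j h1 hnN).le
  have hCS : ∀ j, 1 ≤ j → j ≤ n →
      (∑ k ∈ Finset.Icc 1 (j-1), (L1K α t j (k+1) - L1K α t j k) * G k)^2 ≤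
      ∑ k ∈ Finset.Icc 1 (j-1),
        (L1K α t j (k+1) - L1K α t j k) * (L1K α t k k * (G k)^2) := by
    intro j h1 h2
    have c1 : (∑ k ∈ Finset.Icc 1 (j-1), (L1K α t j (k+1) - L1K α t j k) * G k)^2 ≤
      (∑ k ∈ Finset.Icc 1 (j-1), (L1K α t j (k+1) - L1K α t j k)) *
      ∑ k ∈ Finset.Icc 1 (j-1), (L1K α t j (k+1) - L1K α t j k) * (G k)^2 := by
      apply Finset.sum_sq_le_sum_mul_sum_of_sq_eq_mul
      · intro k hk
        rw [Finset.mem_Icc] at hk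
        exact hd j k hk.1 (by omega) (by omega)
      · intro k hk
        rw [Finset.mem_Icc] at hk
        exact mul_nonneg (hd j k hk.1 (by omega) (by omega)) (sq_nonneg _)
      · intro k hk
        ring
    have c2 : (∑ k ∈ Finset.Icc 1 (j-1), (L1K α t j (k+1) - L1K α t j k)) ≤ L1K α t j j := by
      rw [aux_tele (fun k => L1K α t j k), Nat.sub_add_cancel h1]
      linarith [hA1 j h1 (by omega)]
    refine c1.trans ((mul_le_mul_of_nonneg_right c2 ?_).trans ?_)
    · apply Finset.sum_nonneg
      intro k hk
      rw [Finset.mem_Icc] at hk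
      exact mul_nonneg (hd j k hk.1 (by omega) (by omega)) (sq_nonneg _)
    · rw [Finset.mul_sum]
      apply Finset.sum_le_sum
      intro k hk
      rw [Finset.mem_Icc] at hk
      rw [mul_left_comm]
      exact mul_le_mul_of_nonneg_left
        (mul_le_mul_of_nonneg_right (hanti j k hk.1 (by omega) (by omega)) (sq_nonneg _))
        (hd j k hk.1 (by omega) (by omega))
  have hswap : ∑ j ∈ Finset.Icc 1 n, P n (n-j) * ∑ k ∈ Finset.Icc 1 (j-1),
        (L1K α t j (k+1) - L1K α t j k) * (L1K α t k k * (G k)^2)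
      = ∑ k ∈ Finset.Icc 1 (n-1), P n (n-k) * (L1K α t k k * G k)^2 := by
    simp only [Finset.mul_sum]
    rw [Finset.sum_comm' (t' := Finset.Icc 1 (n-1)) (s' := fun k => Finset.Icc (k+1) n)
      (by intro x y; simp only [Finset.mem_Icc]; omega)]
    apply Finset.sum_congr rfl
    intro k hk
    rw [Finset.mem_Icc] at hk
    have hne := (hapos k hk.1 (by omega)).ne'
    have e : ∑ j ∈ Finset.Icc (k+1) n, (L1K α t j (k+1) - L1K α t j k) * P n (n-j)
        = L1K α t k k * P n (n-k) := by
      rw [hPrec n k hk.1 (by omega) hnN, ← mul_assoc, mul_one_div_cancel hne, one_mul]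
    calc _ = (∑ j ∈ Finset.Icc (k+1) n, (L1K α t j (k+1) - L1K α t j k) * P n (n-j))
          * (L1K α t k k * (G k)^2) := by
          rw [Finset.sum_mul]
          exact Finset.sum_congr rfl (fun j _ => by ring)
      _ = _ := by rw [e]; ring
  rw [← hswap, Finset.mul_sum, Finset.mul_sum, ← Finset.sum_add_distrib]
  apply Finset.sum_le_sum
  intro j hj
  rw [Finset.mem_Icc] at hj
  have b1 := hΥ j hj.1 (by omega)
  have b2 := hCS j hj.1 hj.2
  have b3 := hP _ j rfl hj.1 hj.2
  have b4 := sq_le_sq' (by linarith [abs_nonneg (Υ j)]) b1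
  rw [sq_abs] at b4
  have b5 : (Υ j)^2 ≤ 2 * (L1K α t j j * G j)^2 + 2 * ∑ k ∈ Finset.Icc 1 (j-1),
        (L1K α t j (k+1) - L1K α t j k) * (L1K α t k k * (G k)^2) := by
    refine b4.trans (add_sq_le.trans ?_)
    linarith
  calc _ ≤ _ := mul_le_mul_of_nonneg_left b5 b3
    _ = _ := by ring
end

section
/- (Ratio bound for L1 kernels.) Let 0 < α < 1 and let 0 = t_0 < t_1 < ⋯ < t_N = T be an arbitrary mesh with steps τ_k := t_k − t_{k−1}. The L1 kernels A^{(n,0)}_{n−k} := (ω_{2−α}(t_n − t_{k−1}) − ω_{2−α}(t_n − t_k))/τ_k satisfy, for every 2 ≤ k ≤ N, A^{(k,0)}_0 / A^{(k,0)}_{k−2} < (t_k − t_1)^α τ_k^{−α} / (1−α); equivalently, (1−α) τ_k^α A^{(k,0)}_0 < (t_k − t_1)^α A^{(k,0)}_{k−2}. -/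
lemma core_ineq (α a b : ℝ) (h0 : 0 < α) (h1 : α < 1) (hb : 0 ≤ b) (hab : b < a) :
    (1-α) * (a-b) < a^α * (a^(1-α) - b^(1-α)) := by
  have ha : 0 < a := by linarith
  have hq : b / a < 1 := (div_lt_one ha).2 hab
  have hq0 : 0 ≤ b / a := by positivity
  have h := rpow_one_add_lt_one_add_mul_self (s := b/a - 1) (by linarith) (by linarith)
    (p := 1-α) (by linarith) (by linarith)
  have e : 1 + (b/a - 1) = b/a := by ring
  rw [e, Real.div_rpow hb ha.le] at h
  have hA : a^α * a^(1-α) = a := by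
    rw [← Real.rpow_add ha]; simp
  have hp : 0 < a^(1-α) := Real.rpow_pos_of_pos ha _
  have h2 := mul_lt_mul_of_pos_left h ha
  have e1 : a * (b^(1-α) / a^(1-α)) = a^α * b^(1-α) := by
    rw [mul_div_assoc', div_eq_iff hp.ne']
    linear_combination (-b^(1-α)) * hA
  have e2 : a * (1 + (1-α) * (b/a - 1)) = a + (1-α) * (b - a) := by
    field_simp
  rw [e1, e2] at h2
  rw [mul_sub (a^α), hA]
  linarith

/-- Ratio bound for the L1 kernels:
`A^{(k,0)}_0 / A^{(k,0)}_{k-2} < (t_k - t_1)^α τ_k^{-α}/(1-α)`, equivalently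
`(1-α) τ_k^α A^{(k,0)}_0 < (t_k - t_1)^α A^{(k,0)}_{k-2}`. -/
theorem stmt_12 (N : ℕ) (hN : 1 ≤ N) (α T : ℝ) (hα0 : 0 < α) (hα1 : α < 1)
    (t : ℕ → ℝ) (ht0 : t 0 = 0) (htN : t N = T)
    (htmono : ∀ k : ℕ, 1 ≤ k → k ≤ N → t (k-1) < t k)
    (k : ℕ) (hk : 2 ≤ k) (hkN : k ≤ N) :
    L1K α t k k / L1K α t k 2
        < (t k - t 1) ^ α * (t k - t (k-1)) ^ (-α) / (1-α) ∧
      (1-α) * (t k - t (k-1)) ^ α * L1K α t k k < (t k - t 1) ^ α * L1K α t k 2 := by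
  have hmono : ∀ m : ℕ, 2 ≤ m → m ≤ N → t 2 ≤ t m := by
    intro m hm
    induction m, hm using Nat.le_induction with
    | base => intro _; exact le_rfl
    | succ m hm ih =>
      intro h
      have h1 := htmono (m+1) (by omega) h
      simp only [Nat.add_sub_cancel] at h1
      exact (ih (by omega)).trans h1.le
  have h12 : t 1 < t 2 := htmono 2 (by omega) (by omega)
  have h2k := hmono k hk hkN
  have hs : 0 < t k - t (k-1) := sub_pos.2 (htmono k (by omega) hkN)
  have hG : 0 < Real.Gamma (2-α) := Real.Gamma_pos_of_pos (by linarith)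
  have hc := core_ineq α (t k - t 1) (t k - t 2) hα0 hα1 (by linarith) (by linarith)
  have hp : (2 - α - 1) = 1 - α := by ring
  have hab : t k - t 1 - (t k - t 2) = t 2 - t 1 := by ring
  have h21 : 0 < t 2 - t 1 := by linarith
  rw [hab] at hc
  have hK : (t k - t (k-1)) ^ α * L1K α t k k = 1 / Real.Gamma (2-α) := by
    have hA : (t k - t (k-1))^α * (t k - t (k-1))^(1-α) = t k - t (k-1) := by
      rw [← Real.rpow_add hs]; simp
    unfold L1K om
    rw [hp, sub_self, Real.zero_rpow (by linarith), zero_div, sub_zero, ← mul_div_assoc,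
      ← mul_div_assoc, hA]
    field_simp
  have hK2 : L1K α t k 2 = ((t k - t 1)^(1-α) - (t k - t 2)^(1-α)) / (Real.Gamma (2-α) * (t 2 - t 1)) := by
    unfold L1K om
    rw [hp, ← sub_div, div_div]
  have main : (1-α) * (t k - t (k-1)) ^ α * L1K α t k k < (t k - t 1) ^ α * L1K α t k 2 := by
    rw [mul_assoc, hK, hK2, ← mul_div_assoc, ← mul_div_assoc, mul_one,
      div_lt_div_iff₀ hG (by positivity)]
    have := mul_lt_mul_of_pos_left hc hG
    linarith
  refine ⟨?_, main⟩
  have hKp : 0 < L1K α t k 2 := by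
    rw [hK2]
    apply div_pos _ (by positivity)
    exact sub_pos.2 (Real.rpow_lt_rpow (by linarith) (by linarith) (by linarith))
  have hsα : 0 < (t k - t (k-1))^α := Real.rpow_pos_of_pos hs _
  have h1α : 0 < 1 - α := by linarith
  rw [Real.rpow_neg hs.le, ← div_eq_mul_inv, div_div, div_lt_div_iff₀ hKp (by positivity)]
  linarith
end

section
/- (Mesh-power estimate under graded-type meshes.) Let 0 < α < 1, σ ∈ (α/2, 2), γ ≥ 1, and put β := 2 min{2−α, γ(σ−α/2)}. Let 0 = t_0 < ⋯ < t_N = T be a mesh satisfying condition M-conv with parameters γ and C_γ, and let τ := max_k τ_k. Then there is a constant C > 0, depending only on C_γ, γ, α, σ and T but not on N, such that for all 2 ≤ k ≤ N: t_k^α t_{k−1}^{2σ−4} τ_k^{4−2α} ≤ C t_k^{max{0, 2σ−α−(4−2α)/γ}} τ^β. -/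
/-- Mesh-power estimate under graded-type meshes satisfying M-conv. -/
theorem stmt_14 (α σ γ Cγ T : ℝ) (hα0 : 0 < α) (hα1 : α < 1)
    (hσ0 : α/2 < σ) (hσ2 : σ < 2) (hγ : 1 ≤ γ) (hCγ : 0 < Cγ) (hT : 0 < T) :
    ∃ C : ℝ, 0 < C ∧
      ∀ (N : ℕ) (t : ℕ → ℝ) (τ : ℝ),
        1 ≤ N → t 0 = 0 → t N = T →
        (∀ k : ℕ, 1 ≤ k → k ≤ N → t (k-1) < t k) →
        0 < τ →
        (∀ k : ℕ, 1 ≤ k → k ≤ N → t k - t (k-1) ≤ τ) →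
        (∀ k : ℕ, 1 ≤ k → k ≤ N → t k - t (k-1) ≤ Cγ * τ * min 1 (t k ^ (1 - 1/γ))) →
        (∀ k : ℕ, 2 ≤ k → k ≤ N → t k ≤ Cγ * t (k-1)) →
        (∀ k : ℕ, 2 ≤ k → k ≤ N →
          (t k - t (k-1)) / t k ≤ Cγ * ((t (k-1) - t (k-2)) / t (k-1))) →
        ∀ k : ℕ, 2 ≤ k → k ≤ N →
          t k ^ α * t (k-1) ^ (2*σ - 4) * (t k - t (k-1)) ^ (4 - 2*α)
            ≤ C * t k ^ (max 0 (2*σ - α - (4 - 2*α)/γ))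
                * τ ^ (2 * min (2 - α) (γ * (σ - α/2))) := by
  set β : ℝ := 2 * min (2 - α) (γ * (σ - α/2)) with hβ
  have hγ0 : 0 < γ := by linarith
  have hβ0 : 0 ≤ β := by
    have : 0 ≤ min (2 - α) (γ * (σ - α/2)) :=
      le_min (by linarith) (mul_nonneg hγ0.le (by linarith))
    linarith
  have hβ1 : β ≤ 4 - 2*α := by
    have := min_le_left (2 - α) (γ * (σ - α/2))
    linarith
  have hexp : max 0 (2*σ - α - (4 - 2*α)/γ) = 2*σ - α - β/γ := by
    rcases le_total (2 - α) (γ * (σ - α/2)) with h | h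
    · have hb : β = 4 - 2*α := by rw [hβ, min_eq_left h]; ring
      rw [hb]
      apply max_eq_right
      have : (4 - 2*α)/γ ≤ 2*σ - α := by
        rw [div_le_iff₀ hγ0]; linarith
      linarith
    · have hb : β / γ = 2*σ - α := by rw [hβ, min_eq_right h]; field_simp
      rw [hb, sub_self]
      apply max_eq_left
      have : 2*σ - α ≤ (4 - 2*α)/γ := by
        rw [le_div_iff₀ hγ0]; linarith
      linarith
  refine ⟨Cγ ^ (4 - 2*σ) * Cγ ^ β, by positivity, ?_⟩
  intro N t τ hN h0 hTN hmono hτ hmax hM1 hM2 hM3 k hk hkN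
  have hpos : ∀ j : ℕ, 1 ≤ j → j ≤ N → 0 < t j := by
    intro j hj
    induction j, hj using Nat.le_induction with
    | base => intro hjN; have := hmono 1 le_rfl hjN; simpa [h0] using this
    | succ n hn ih =>
      intro hjN
      have h1 := hmono (n+1) (by omega) hjN
      have h2 := ih (by omega)
      simp only [Nat.add_sub_cancel] at h1
      linarith
  have hs := hpos k (by omega) hkN
  have hr := hpos (k-1) (by omega) (by omega)
  have hh := hmono k (by omega) hkN
  have h1 := hM1 k (by omega) hkN
  have h2 := hM2 k hk hkN
  rw [hexp]
  generalize t k = s at *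
  generalize t (k-1) = r at *
  obtain ⟨h, hhd⟩ : ∃ h, h = s - r := ⟨_, rfl⟩
  rw [← hhd] at h1 ⊢
  have hh0 : 0 < h := by linarith
  have hhs : h ≤ s := by linarith
  have h3 : h ≤ Cγ * τ * s ^ (1 - 1/γ) :=
    h1.trans (mul_le_mul_of_nonneg_left (min_le_right _ _) (by positivity))
  have e1 : r ^ (2*σ - 4) ≤ Cγ ^ (4 - 2*σ) * s ^ (2*σ - 4) := by
    have hle : s / Cγ ≤ r := by rw [div_le_iff₀ hCγ]; linarith
    have := Real.rpow_le_rpow_of_nonpos (by positivity) hle (by linarith : 2*σ - 4 ≤ 0)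
    rw [Real.div_rpow hs.le hCγ.le, div_eq_mul_inv, ← Real.rpow_neg hCγ.le,
      show -(2*σ - 4) = 4 - 2*σ by ring] at this
    rw [mul_comm (Cγ ^ _)]; exact this
  have e2 : h ^ (4 - 2*α) ≤ (Cγ ^ β * τ ^ β * s ^ ((1 - 1/γ) * β)) * s ^ (4 - 2*α - β) := by
    have a1 := Real.rpow_le_rpow hh0.le h3 hβ0
    rw [Real.mul_rpow (by positivity) (by positivity), Real.mul_rpow hCγ.le hτ.le,
      ← Real.rpow_mul hs.le] at a1
    have a2 := Real.rpow_le_rpow hh0.le hhs (by linarith : 0 ≤ 4 - 2*α - β)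
    calc h ^ (4 - 2*α) = h ^ β * h ^ (4 - 2*α - β) := by
          rw [← Real.rpow_add hh0]; congr 1; ring
      _ ≤ _ := mul_le_mul a1 a2 (by positivity) (by positivity)
  have e3 : s ^ (2*σ - α - β/γ) =
      s ^ α * s ^ (2*σ - 4) * s ^ ((1 - 1/γ) * β) * s ^ (4 - 2*α - β) := by
    rw [← Real.rpow_add hs, ← Real.rpow_add hs, ← Real.rpow_add hs]
    congr 1; ring
  calc s ^ α * r ^ (2*σ - 4) * h ^ (4 - 2*α)
      ≤ s ^ α * (Cγ ^ (4 - 2*σ) * s ^ (2*σ - 4)) *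
        ((Cγ ^ β * τ ^ β * s ^ ((1 - 1/γ) * β)) * s ^ (4 - 2*α - β)) := by
        gcongr
    _ = _ := by rw [e3]; ring
end

section
/- (Monotonicity of the nonuniform Alikhanov kernels.) Let 0 < α < 1, θ := α/2, and let 0 = t_0 < ⋯ < t_N = T be a mesh with steps τ_k := t_k − t_{k−1} and step ratios ρ_k := τ_k/τ_{k+1} satisfying ρ_k ≤ 7/4 for all k. Then the Alikhanov kernels A^{(n,θ)}_{n−k} satisfy: (I) for every n ≥ 2 and 1 ≤ k ≤ n−1, A^{(n,θ)}_{n−k−1} − A^{(n,θ)}_{n−k} ≥ (1+ρ_k) b^{(n)}_{n−k} − (1/(5τ_k)) ∫_{t_{k−1}}^{t_k} (t_k − s) ω_{−α}(t_{n−θ} − s) ds > 0; (II) for every n ≥ 2, A^{(n,θ)}_0 − A^{(n,θ)}_1 > θ (2 A^{(n,θ)}_0 − A^{(n,θ)}_1). -/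
/-- Weighted time point `t_{n-θ} := θ t_{n-1} + (1-θ) t_n`. -/
noncomputable def tw (θ : ℝ) (t : ℕ → ℝ) (n : ℕ) : ℝ := θ * t (n-1) + (1-θ) * t n

/-- Step ratio `ρ_k = τ_k / τ_{k+1}`. -/
noncomputable def rhok (t : ℕ → ℝ) (k : ℕ) : ℝ := (t k - t (k-1)) / (t (k+1) - t k)

/-- Alikhanov coefficient `a^{(n)}_{n-k}` (with `a^{(n)}_0` given by the `k = n` case). -/
noncomputable def aco (α : ℝ) (t : ℕ → ℝ) (n k : ℕ) : ℝ :=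
  if k = n then
    (1 / (t n - t (n-1))) *
      ∫ s in (t (n-1))..(tw (α/2) t n), (tw (α/2) t n - s) ^ (-α) / Real.Gamma (1-α)
  else
    (1 / (t k - t (k-1))) *
      ∫ s in (t (k-1))..(t k), (tw (α/2) t n - s) ^ (-α) / Real.Gamma (1-α)

/-- Alikhanov coefficient `b^{(n)}_{n-k}` for `1 ≤ k ≤ n-1`. -/
noncomputable def bco (α : ℝ) (t : ℕ → ℝ) (n k : ℕ) : ℝ :=
  (2 / ((t k - t (k-1)) * ((t k - t (k-1)) + (t (k+1) - t k)))) *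
    ∫ s in (t (k-1))..(t k),
      (s - (t (k-1) + t k)/2) * ((tw (α/2) t n - s) ^ (-α) / Real.Gamma (1-α))

/-- Alikhanov discrete kernel `AK α t n k = A^{(n,θ)}_{n-k}` with `θ = α/2`. -/
noncomputable def AK (α : ℝ) (t : ℕ → ℝ) (n k : ℕ) : ℝ :=
  if n ≤ 1 then aco α t n n
  else if k = n then aco α t n n + rhok t (n-1) * bco α t n (n-1)
  else if k = 1 then aco α t n 1 - bco α t n 1
  else aco α t n k + rhok t (k-1) * bco α t n (k-1) - bco α t n k

lemma key_int (a b : ℝ) (hab : a < b) (w w' : ℝ → ℝ)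
    (hd : ∀ s ∈ Set.Icc a b, HasDerivAt w (w' s) s)
    (hc : ContinuousOn w' (Set.Icc a b)) (hm : MonotoneOn w' (Set.Icc a b)) (hp : 0 < w' a) :
    (∫ s in a..b, (b - s) * w' s) = (∫ s in a..b, w s) - (b - a) * w a ∧
    (∫ s in a..b, w s) - (b - a) * w a ≤ (b - a) * w b - (∫ s in a..b, w s) ∧
    (b - a)^2 / 2 * w' a ≤ (b - a) * w b - (∫ s in a..b, w s) ∧
    0 < (∫ s in a..b, (s - (a + b)/2) * w s) ∧
    (∫ s in a..b, (s - (a + b)/2) * w s) ≤ (b - a)^3 / 12 * w' b ∧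
    2 * (∫ s in a..b, (s - (a + b)/2) * w s) ≤ (b - a) * (∫ s in a..b, (b - s) * w' s) ∧
    0 < (∫ s in a..b, (b - s) * w' s) := by
  have hu : Set.uIcc a b = Set.Icc a b := Set.uIcc_of_le hab.le
  have hwc : ContinuousOn w (Set.Icc a b) := fun s hs => (hd s hs).continuousAt.continuousWithinAt
  have hwi : IntervalIntegrable w MeasureTheory.volume a b := by
    apply ContinuousOn.intervalIntegrable; rwa [hu]
  have hpi : IntervalIntegrable w' MeasureTheory.volume a b := by
    apply ContinuousOn.intervalIntegrable; rwa [hu]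
  have hii : ∀ f : ℝ → ℝ, Continuous f →
      IntervalIntegrable (fun s => f s * w' s) MeasureTheory.volume a b := by
    intro f hf
    apply ContinuousOn.intervalIntegrable; rw [hu]; exact hf.continuousOn.mul hc
  have hci : ∀ f : ℝ → ℝ, Continuous f →
      IntervalIntegrable f MeasureTheory.volume a b := fun f hf => hf.intervalIntegrable _ _
  have hwa : ∀ s ∈ Set.Icc a b, w' a ≤ w' s := fun s hs => hm ⟨le_rfl, hab.le⟩ hs hs.1
  have hwb : ∀ s ∈ Set.Icc a b, w' s ≤ w' b := fun s hs => hm hs ⟨hab.le, le_rfl⟩ hs.2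
  have e1 : (∫ s in a..b, (b - s) * w' s) = (∫ s in a..b, w s) - (b - a) * w a := by
    have := intervalIntegral.integral_mul_deriv_eq_deriv_mul (a := a) (b := b)
      (u := fun s => b - s) (u' := fun _ => -1) (v := w) (v' := w')
      (fun s _ => by simpa using (hasDerivAt_id s).const_sub b)
      (fun s hs => hd s (hu ▸ hs)) (hci _ (by fun_prop)) hpi
    rw [this]; simp; ring
  have e2 : (∫ s in a..b, (s - a) * w' s) = (b - a) * w b - (∫ s in a..b, w s) := by
    have := intervalIntegral.integral_mul_deriv_eq_deriv_mul (a := a) (b := b)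
      (u := fun s => s - a) (u' := fun _ => 1) (v := w) (v' := w')
      (fun s _ => by simpa using (hasDerivAt_id s).sub_const a)
      (fun s hs => hd s (hu ▸ hs)) (hci _ (by fun_prop)) hpi
    rw [this]; simp
  have e3 : (∫ s in a..b, ((s - a) * (b - s)) * w' s)
      = 2 * (∫ s in a..b, (s - (a + b)/2) * w s) := by
    have := intervalIntegral.integral_mul_deriv_eq_deriv_mul (a := a) (b := b)
      (u := fun s => (s - a) * (b - s)) (u' := fun s => -2 * (s - (a + b)/2)) (v := w) (v' := w')
      (fun s _ => by
        have := ((hasDerivAt_id s).sub_const a).mul ((hasDerivAt_id s).const_sub b)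
        refine HasDerivAt.congr_deriv (f := fun s => (s - a) * (b - s)) this ?_
        simp only [id]; ring)
      (fun s hs => hd s (hu ▸ hs)) (hci _ (by fun_prop)) hpi
    rw [this]
    simp only [mul_assoc, intervalIntegral.integral_const_mul]
    ring
  have p1 : ∀ c : ℝ, (∫ s in a..b, (s - a) * c) = (b - a)^2/2 * c := by
    intro c
    rw [intervalIntegral.integral_mul_const, intervalIntegral.integral_sub (hci _ (by fun_prop))
      (hci _ (by fun_prop))]
    congr 1; simp; ring
  have p1' : ∀ c : ℝ, (∫ s in a..b, (b - s) * c) = (b - a)^2/2 * c := by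
    intro c
    rw [intervalIntegral.integral_mul_const, intervalIntegral.integral_sub (hci _ (by fun_prop))
      (hci _ (by fun_prop))]
    congr 1; simp; ring
  have p2 : ∀ c : ℝ, (∫ s in a..b, ((s - a) * (b - s)) * c) = (b - a)^3/6 * c := by
    intro c
    have : (fun s : ℝ => (s - a) * (b - s)) = fun s => ((a + b) * s - s^2) - a * b := by
      funext s; ring
    rw [intervalIntegral.integral_mul_const, this,
      intervalIntegral.integral_sub (hci _ (by fun_prop)) (hci _ (by fun_prop)),
      intervalIntegral.integral_sub (hci _ (by fun_prop)) (hci _ (by fun_prop)),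
      intervalIntegral.integral_const_mul]
    congr 1; simp; ring
  have q1 : (b - a)^2/2 * w' a ≤ ∫ s in a..b, (s - a) * w' s := by
    rw [← p1]
    exact intervalIntegral.integral_mono_on hab.le (hci _ (by fun_prop)) (hii _ (by fun_prop))
      (fun s hs => mul_le_mul_of_nonneg_left (hwa s hs) (by linarith [hs.1]))
  have q1' : (b - a)^2/2 * w' a ≤ ∫ s in a..b, (b - s) * w' s := by
    rw [← p1']
    exact intervalIntegral.integral_mono_on hab.le (hci _ (by fun_prop)) (hii _ (by fun_prop))
      (fun s hs => mul_le_mul_of_nonneg_left (hwa s hs) (by linarith [hs.2]))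
  have q2 : (b - a)^3/6 * w' a ≤ ∫ s in a..b, ((s - a) * (b - s)) * w' s := by
    rw [← p2]
    exact intervalIntegral.integral_mono_on hab.le (hci _ (by fun_prop)) (hii _ (by fun_prop))
      (fun s hs => mul_le_mul_of_nonneg_left (hwa s hs)
        (mul_nonneg (by linarith [hs.1]) (by linarith [hs.2])))
  have q3 : (∫ s in a..b, ((s - a) * (b - s)) * w' s) ≤ (b - a)^3/6 * w' b := by
    rw [← p2]
    exact intervalIntegral.integral_mono_on hab.le (hii _ (by fun_prop)) (hci _ (by fun_prop))
      (fun s hs => mul_le_mul_of_nonneg_left (hwb s hs)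
        (mul_nonneg (by linarith [hs.1]) (by linarith [hs.2])))
  have q4 : (∫ s in a..b, ((s - a) * (b - s)) * w' s) ≤ (b - a) * ∫ s in a..b, (b - s) * w' s := by
    rw [← intervalIntegral.integral_const_mul]
    refine intervalIntegral.integral_mono_on hab.le (hii _ (by fun_prop))
      ((hii _ (by fun_prop)).const_mul _) (fun s hs => ?_)
    have h1 : 0 ≤ (b - s) * w' s :=
      mul_nonneg (by linarith [hs.2]) (hp.le.trans (hwa s hs))
    have h2 : s - a ≤ b - a := by linarith [hs.2]
    rw [mul_assoc]
    exact mul_le_mul_of_nonneg_right h2 h1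
  have q5 : (∫ s in a..b, (b - s) * w' s) ≤ ∫ s in a..b, (s - a) * w' s := by
    have hmid : (a + b)/2 ∈ Set.Icc a b := ⟨by linarith, by linarith⟩
    have h : (∫ s in a..b, ((b - s) * w' s + (s - a) * w' ((a+b)/2)))
        ≤ ∫ s in a..b, ((s - a) * w' s + (b - s) * w' ((a+b)/2)) := by
      refine intervalIntegral.integral_mono_on hab.le
        ((hii _ (by fun_prop)).add (hci _ (by fun_prop)))
        ((hii _ (by fun_prop)).add (hci _ (by fun_prop))) (fun s hs => ?_)
      rcases le_total s ((a+b)/2) with h | h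
      · have := hm hs hmid h
        nlinarith
      · have := hm hmid hs h
        nlinarith
    rw [intervalIntegral.integral_add (hii _ (by fun_prop)) (hci _ (by fun_prop)),
      intervalIntegral.integral_add (hii _ (by fun_prop)) (hci _ (by fun_prop)), p1, p1'] at h
    linarith
  have hb : 0 < b - a := by linarith
  have z1 : 0 < (b - a)^3/6 * w' a := by positivity
  have z2 : 0 < (b - a)^2/2 * w' a := by positivity
  refine ⟨e1, ?_, ?_, ?_, ?_, ?_, ?_⟩ <;> linarith

/-- all facts on one interval, for the kernel -/
lemma key_w (α a b x : ℝ) (hα0 : 0 < α) (hα1 : α < 1) (hab : a < b) (hbx : b < x) :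
    let w : ℝ → ℝ := fun s => (x - s) ^ (-α) / Real.Gamma (1-α)
    let w' : ℝ → ℝ := fun s => -((x - s) ^ (-α - 1) / Real.Gamma (-α))
    0 < w' a ∧
    (∫ s in a..b, (b - s) * w' s) = (∫ s in a..b, w s) - (b - a) * w a ∧
    (∫ s in a..b, w s) - (b - a) * w a ≤ (b - a) * w b - (∫ s in a..b, w s) ∧
    (b - a)^2 / 2 * w' a ≤ (b - a) * w b - (∫ s in a..b, w s) ∧
    0 < (∫ s in a..b, (s - (a + b)/2) * w s) ∧
    (∫ s in a..b, (s - (a + b)/2) * w s) ≤ (b - a)^3 / 12 * w' b ∧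
    2 * (∫ s in a..b, (s - (a + b)/2) * w s) ≤ (b - a) * (∫ s in a..b, (b - s) * w' s) ∧
    0 < (∫ s in a..b, (b - s) * w' s) := by
  intro w w'
  have hG1 : 0 < Real.Gamma (1-α) := Real.Gamma_pos_of_pos (by linarith)
  have hG : Real.Gamma (1-α) = -α * Real.Gamma (-α) := by
    rw [← Real.Gamma_add_one (by linarith)]; ring_nf
  have hGn : Real.Gamma (-α) < 0 := by nlinarith
  have hw' : ∀ s, w' s = α / Real.Gamma (1-α) * (x - s) ^ (-α - 1) := by
    intro s
    simp only [w', hG]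
    field_simp
  have hpa : 0 < w' a := by
    rw [hw']
    have : 0 < (x - a) ^ (-α - 1) := Real.rpow_pos_of_pos (by linarith) _
    positivity
  refine ⟨hpa, key_int a b hab w w' ?_ ?_ ?_ hpa⟩
  · intro s hs
    have hx : 0 < x - s := by linarith [hs.2]
    have h := (((hasDerivAt_id s).const_sub x).rpow_const (p := -α)
      (Or.inl hx.ne')).div_const (Real.Gamma (1-α))
    refine HasDerivAt.congr_deriv (f := w) h ?_
    rw [hw']
    simp only [id]
    ring
  · intro s hs
    have hx : 0 < x - s := by linarith [hs.2]
    apply ContinuousAt.continuousWithinAt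
    have h : ContinuousAt (fun s => x - s) s := by fun_prop
    exact ((h.rpow_const (Or.inl hx.ne')).div_const _).neg
  · intro s hs r hr hsr
    rw [hw', hw']
    apply mul_le_mul_of_nonneg_left _ (by positivity)
    exact Real.rpow_le_rpow_of_nonpos (by linarith [hr.2]) (by linarith) (by linarith)

lemma a_zero (α a x τ : ℝ) (hα0 : 0 < α) (hα1 : α < 1) (hτ : 0 < τ)
    (hx : x - a = (1 - α/2) * τ) :
    (1 - α) * ((1/τ) * ∫ s in a..x, (x - s) ^ (-α) / Real.Gamma (1-α))
      = (1 - α/2) * ((x - a) ^ (-α) / Real.Gamma (1-α)) := by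
  have hG1 : 0 < Real.Gamma (1-α) := Real.Gamma_pos_of_pos (by linarith)
  have hpos : 0 < x - a := by rw [hx]; apply mul_pos <;> linarith
  have h1 : (∫ s in a..x, (x - s) ^ (-α)) = (x - a) ^ (-α) * (x - a) / (1 - α) := by
    rw [intervalIntegral.integral_comp_sub_left (fun s => s ^ (-α)) x, sub_self,
      integral_rpow (Or.inl (by linarith)), Real.zero_rpow (by linarith),
      Real.rpow_add_one hpos.ne']
    rw [sub_zero]; congr 1; ring
  rw [intervalIntegral.integral_div, h1]
  have : (1 - α) ≠ 0 := by linarith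
  rw [mul_div_assoc ((x-a)^(-α)) (x-a), hx]
  field_simp

lemma cub (τ σ g : ℝ) (hτ : 0 < τ) (hσ : 0 < σ) (hg : 0 ≤ g) (B : ℝ) (hr : τ / σ ≤ 7/4)
    (hB : B ≤ τ^3/12 * g) :
    τ / σ * (2 / (τ * (τ + σ)) * B) ≤ 2/5 * σ * g := by
  have e : τ / σ * (2 / (τ * (τ + σ)) * B) = 2 * B / (σ * (τ + σ)) := by field_simp
  rw [e, div_le_iff₀ (by positivity)]
  have hr' : τ ≤ 7/4 * σ := by rwa [div_le_iff₀ hσ] at hr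
  have h2 : τ^2 ≤ (7/4*σ)^2 := by gcongr
  have h3 : τ^3/6 ≤ 2/5 * σ * (σ * (τ + σ)) := by
    nlinarith [mul_le_mul_of_nonneg_left h2 hτ.le, mul_pos hσ hσ, mul_le_mul_of_nonneg_left hr' (mul_pos hσ hσ).le]
  have := mul_le_mul_of_nonneg_right h3 hg
  nlinarith

/-- Monotonicity of the nonuniform Alikhanov kernels (Theorem 2.2 (I)-(II)). -/
theorem stmt_15 (N : ℕ) (hN : 1 ≤ N) (α T : ℝ) (hα0 : 0 < α) (hα1 : α < 1)
    (t : ℕ → ℝ) (ht0 : t 0 = 0) (htN : t N = T)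
    (htmono : ∀ k : ℕ, 1 ≤ k → k ≤ N → t (k-1) < t k)
    (hρ : ∀ k : ℕ, 1 ≤ k → k ≤ N - 1 → rhok t k ≤ 7/4) :
    (∀ n k : ℕ, 2 ≤ n → n ≤ N → 1 ≤ k → k ≤ n - 1 →
      (1 + rhok t k) * bco α t n k
          - (1 / (5 * (t k - t (k-1)))) *
            ∫ s in (t (k-1))..(t k),
              (t k - s) * ((tw (α/2) t n - s) ^ (-α - 1) / Real.Gamma (-α))
        ≤ AK α t n (k+1) - AK α t n k ∧
      0 < (1 + rhok t k) * bco α t n k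
          - (1 / (5 * (t k - t (k-1)))) *
            ∫ s in (t (k-1))..(t k),
              (t k - s) * ((tw (α/2) t n - s) ^ (-α - 1) / Real.Gamma (-α))) ∧
    (∀ n : ℕ, 2 ≤ n → n ≤ N →
      (α/2) * (2 * AK α t n n - AK α t n (n-1)) < AK α t n n - AK α t n (n-1)) := by
  have tpos : ∀ n k : ℕ, n ≤ N → 1 ≤ k → k ≤ n → t (k-1) < t k :=
    fun n k hn hk hkn => htmono k hk (hkn.trans hn)
  -- t k ≤ t (n-1) < tw
  have tle : ∀ m k : ℕ, k ≤ m → m ≤ N → t k ≤ t m := by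
    intro m k hkm
    induction m, hkm using Nat.le_induction with
    | base => intro _; exact le_rfl
    | succ m hm ih =>
      intro h
      have := htmono (m+1) (by omega) h
      simp only [Nat.add_sub_cancel] at this
      linarith [ih (by omega)]
  have xlt : ∀ n k : ℕ, 2 ≤ n → n ≤ N → k ≤ n - 1 → t k < tw (α/2) t n := by
    intro n k h2 hn hk
    have h1 := tle (n-1) k hk (by omega)
    have h3 := htmono n (by omega) hn
    unfold tw
    nlinarith
  have F : ∀ n k : ℕ, 2 ≤ n → n ≤ N → 1 ≤ k → k ≤ n - 1 → _ := fun n k h2 hn hk hkn =>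
    key_w α (t (k-1)) (t k) (tw (α/2) t n) hα0 hα1 (htmono k hk (by omega)) (xlt n k h2 hn hkn)
  set w : ℕ → ℝ → ℝ := fun n s => (tw (α/2) t n - s) ^ (-α) / Real.Gamma (1-α) with hw
  set w' : ℕ → ℝ → ℝ := fun n s => -((tw (α/2) t n - s) ^ (-α - 1) / Real.Gamma (-α)) with hw'
  simp only at F
  have Bpos : ∀ n k : ℕ, 2 ≤ n → n ≤ N → 1 ≤ k → k ≤ n - 1 → 0 < bco α t n k := by
    intro n k h2 hn hk hkn
    have h1 := htmono k hk (by omega)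
    have h3 := htmono (k+1) (by omega) (by omega)
    simp only [Nat.add_sub_cancel] at h3
    obtain ⟨-, -, -, -, hB, -⟩ := F n k h2 hn hk hkn
    unfold bco
    have : 0 < t k - t (k-1) := by linarith
    have : 0 < t (k+1) - t k := by linarith
    exact mul_pos (by positivity) hB
  have Rpos : ∀ n k : ℕ, n ≤ N → 1 ≤ k → k ≤ n - 1 → 0 < rhok t k := by
    intro n k hn hk hkn
    have h1 := htmono k hk (by omega)
    have h3 := htmono (k+1) (by omega) (by omega)
    simp only [Nat.add_sub_cancel] at h3
    unfold rhok
    exact div_pos (by linarith) (by linarith)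
  have H1 : ∀ n k : ℕ, 2 ≤ n → n ≤ N → 1 ≤ k → k ≤ n - 1 →
      w n (t (k-1)) ≤ aco α t n k - bco α t n k := by
    intro n k h2 hn hk hkn
    have h1 := htmono k hk (by omega)
    have h3 := htmono (k+1) (by omega) (by omega)
    simp only [Nat.add_sub_cancel] at h3
    obtain ⟨-, e, -, -, -, -, hB, hK⟩ := F n k h2 hn hk hkn
    have p1 : 0 < t k - t (k-1) := by linarith
    have p2 : 0 < t (k+1) - t k := by linarith
    unfold aco bco
    rw [if_neg (by omega)]
    set τ := t k - t (k-1)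
    set σ := t (k+1) - t k
    set K := ∫ s in (t (k-1))..(t k), (t k - s) *
      -((tw (α/2) t n - s) ^ (-α - 1) / Real.Gamma (-α))
    set A := ∫ s in (t (k-1))..(t k), (tw (α/2) t n - s) ^ (-α) / Real.Gamma (1-α)
    set B := ∫ s in (t (k-1))..(t k), (s - (t (k-1) + t k)/2) *
      ((tw (α/2) t n - s) ^ (-α) / Real.Gamma (1-α))
    have e1 : 1 / τ * A = K / τ + w n (t (k-1)) := by
      rw [e]; field_simp; simp only [hw]; ring
    have e2 : 2 / (τ * (τ + σ)) * B ≤ K / τ := by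
      rw [div_mul_eq_mul_div, div_le_div_iff₀ (by positivity) p1]
      nlinarith [mul_pos p1 (mul_pos p2 hK), mul_pos p1 hK]
    linarith
  have H1' : ∀ n : ℕ, 2 ≤ n → n ≤ N → (1 - α) * aco α t n n = (1 - α/2) * w n (t (n-1)) := by
    intro n h2 hn
    have h1 := htmono n (by omega) hn
    unfold aco
    rw [if_pos rfl]
    exact a_zero α _ _ _ hα0 hα1 (by linarith) (by unfold tw; ring)
  have Wpos : ∀ n k : ℕ, 2 ≤ n → n ≤ N → k ≤ n - 1 → 0 < w n (t k) := by
    intro n k h2 hn hk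
    exact div_pos (Real.rpow_pos_of_pos (by linarith [xlt n k h2 hn hk]) _)
      (Real.Gamma_pos_of_pos (by linarith))
  have H2 : ∀ n k : ℕ, 2 ≤ n → n ≤ N → 1 ≤ k → k + 1 ≤ n - 1 →
      rhok t k * bco α t n k ≤ 2/5 * (t (k+1) - t k) * w' n (t k) := by
    intro n k h2 hn hk hkn
    have h1 := htmono k hk (by omega)
    have h3 := htmono (k+1) (by omega) (by omega)
    simp only [Nat.add_sub_cancel] at h3
    obtain ⟨-, -, -, -, -, hB, -, -⟩ := F n k h2 hn hk (by omega)
    obtain ⟨hg, -⟩ := F n (k+1) h2 hn (by omega) hkn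
    have hr := hρ k hk (by omega)
    exact cub _ _ _ (by linarith) (by linarith) hg.le _ hr hB
  have H3 : ∀ n k : ℕ, 2 ≤ n → n ≤ N → 1 ≤ k → k ≤ n - 1 →
      0 < w' n (t (k-1)) ∧
      1/2 * (t k - t (k-1)) * w' n (t (k-1)) ≤ w n (t k) - aco α t n k ∧
      0 < -((1 / (5 * (t k - t (k-1)))) * ∫ s in (t (k-1))..(t k),
              (t k - s) * ((tw (α/2) t n - s) ^ (-α - 1) / Real.Gamma (-α))) ∧
      -((1 / (5 * (t k - t (k-1)))) * ∫ s in (t (k-1))..(t k),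
              (t k - s) * ((tw (α/2) t n - s) ^ (-α - 1) / Real.Gamma (-α)))
        ≤ 1/5 * (w n (t k) - aco α t n k) := by
    intro n k h2 hn hk hkn
    have h1 := htmono k hk (by omega)
    obtain ⟨hg, e, c2, c3, -, -, -, hK⟩ := F n k h2 hn hk hkn
    simp only [mul_neg, intervalIntegral.integral_neg] at e hK
    have p1 : 0 < t k - t (k-1) := by linarith
    unfold aco
    rw [if_neg (by omega)]
    set τ := t k - t (k-1)
    set K := ∫ s in (t (k-1))..(t k), (t k - s) *
      ((tw (α/2) t n - s) ^ (-α - 1) / Real.Gamma (-α))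
    set A := ∫ s in (t (k-1))..(t k), (tw (α/2) t n - s) ^ (-α) / Real.Gamma (1-α)
    have e0 : w n (t k) - 1 / τ * A = (τ * w n (t k) - A) / τ := by field_simp
    have e1 : -(1 / (5 * τ) * K) = 1/5 * ((-K) / τ) := by field_simp
    refine ⟨hg, ?_, ?_, ?_⟩
    · rw [e0, le_div_iff₀ p1]
      have : τ^2 / 2 * w' n (t (k-1)) ≤ τ * w n (t k) - A := c3
      linarith
    · rw [e1]; positivity
    · rw [e1, e0]
      have : -K ≤ τ * w n (t k) - A := by rw [e]; exact c2
      gcongr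
  -- upper bound for A_{n-k} + b_{n-k}
  have U : ∀ n k : ℕ, 2 ≤ n → n ≤ N → 1 ≤ k → k ≤ n - 1 →
      AK α t n k ≤ aco α t n k - bco α t n k + 4/5 * (w n (t k) - aco α t n k) := by
    intro n k h2 hn hk hkn
    obtain ⟨hg, h3, -, -⟩ := H3 n k h2 hn hk hkn
    have h1 := htmono k hk (by omega)
    have hpos : 0 < (t k - t (k-1)) * w' n (t (k-1)) := mul_pos (by linarith) hg
    unfold AK
    rw [if_neg (by omega), if_neg (by omega)]
    split_ifs with h
    · subst h; linarith
    · have := H2 n (k-1) h2 hn (by omega) (by omega)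
      rw [Nat.sub_add_cancel hk] at this
      linarith
  refine ⟨?_, ?_⟩
  · intro n k h2 hn hk hkn
    obtain ⟨hg, h3, h4, h5⟩ := H3 n k h2 hn hk hkn
    have hU := U n k h2 hn hk hkn
    have hB := Bpos n k h2 hn hk hkn
    have hR := Rpos n k hn hk hkn
    refine ⟨?_, by nlinarith [mul_pos hR hB]⟩
    have L : w n (t k) + rhok t k * bco α t n k ≤ AK α t n (k+1) := by
      unfold AK
      rw [if_neg (by omega)]
      split_ifs with c1 c2
      · obtain rfl : k = n - 1 := by omega
        have h6 := H1' n h2 hn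
        have := Wpos n (n-1) h2 hn le_rfl
        nlinarith
      · omega
      · have := H1 n (k+1) h2 hn (by omega) (by omega)
        simp only [Nat.add_sub_cancel] at this ⊢
        linarith
    linarith
  · intro n h2 hn
    obtain ⟨hg, h3, h4, h5⟩ := H3 n (n-1) h2 hn (by omega) le_rfl
    have hU := U n (n-1) h2 hn (by omega) le_rfl
    have hB := Bpos n (n-1) h2 hn (by omega) le_rfl
    have hR := Rpos n (n-1) hn (by omega) le_rfl
    have h6 := H1' n h2 hn
    have hA : AK α t n n = aco α t n n + rhok t (n-1) * bco α t n (n-1) := by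
      unfold AK
      rw [if_neg (by omega), if_pos rfl]
    have hlt : AK α t n (n-1) < w n (t (n-1)) := by linarith
    have hRB := mul_pos hR hB
    rw [hA]
    nlinarith
end

section
/- (Two-sided bounds for the nonuniform Alikhanov kernels.) Let 0 < α < 1, θ := α/2, and let 0 = t_0 < ⋯ < t_N = T be a mesh with steps τ_k := t_k − t_{k−1} and step ratios ρ_k := τ_k/τ_{k+1} satisfying ρ_k ≤ 7/4 for all k. Then for every 1 ≤ k ≤ n ≤ N the Alikhanov kernels satisfy A^{(n,θ)}_{n−k} ≤ A^{(n,θ)}_0 ≤ (24/(11 τ_n)) ∫_{t_{n−1}}^{t_n} ω_{1−α}(t_n − s) ds, with A^{(n,θ)}_{n−k} < A^{(n,θ)}_0 for k < n, and A^{(n,θ)}_{n−k} ≥ (4/(11 τ_k)) ∫_{t_{k−1}}^{t_k} ω_{1−α}(t_n − s) ds. -/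
open intervalIntegral in
theorem hp_b_nonneg (F : ℝ → ℝ) (a b : ℝ) (hab : a < b) (hc : ContinuousOn F (Set.Icc a b))
    (hm : MonotoneOn F (Set.Icc a b)) : 0 ≤ ∫ s in a..b, (s - (a+b)/2) * F s := by
  have hF : IntervalIntegrable F MeasureTheory.volume a b := by
    apply ContinuousOn.intervalIntegrable; rwa [Set.uIcc_of_le hab.le]
  have e : ∫ s in a..b, (s - (a+b)/2) * F ((a+b)/2) = 0 := by
    rw [intervalIntegral.integral_mul_const, intervalIntegral.integral_sub (by simp) (by simp)]
    simp only [integral_id, integral_const, smul_eq_mul]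
    ring
  rw [← e]
  apply integral_mono_on hab.le
  · apply Continuous.intervalIntegrable; fun_prop
  · exact hF.continuousOn_mul (by fun_prop)
  · intro s hs
    have hmid : (a+b)/2 ∈ Set.Icc a b := ⟨by linarith, by linarith⟩
    rcases le_total s ((a+b)/2) with h | h
    · have := hm hs hmid h
      nlinarith
    · have := hm hmid hs h
      nlinarith

open intervalIntegral in
theorem hp_b_le (F : ℝ → ℝ) (a b S : ℝ) (hab : a < b) (hc : ContinuousOn F (Set.Icc a b))
    (hS : ∀ x ∈ Set.Icc a b, ∀ y ∈ Set.Icc a b, x < y → F y - F x ≤ S * (y - x)) :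
    ∫ s in a..b, (s - (a+b)/2) * F s ≤ S * (b-a)^3 / 12 := by
  have hF : IntervalIntegrable F MeasureTheory.volume a b := by
    apply ContinuousOn.intervalIntegrable; rwa [Set.uIcc_of_le hab.le]
  have e : ∫ s in a..b, ((s - (a+b)/2) * F ((a+b)/2) + S * (s - (a+b)/2)^2) = S * (b-a)^3 / 12 := by
    rw [intervalIntegral.integral_add
      (by apply Continuous.intervalIntegrable; fun_prop)
      (by apply Continuous.intervalIntegrable; fun_prop),
      intervalIntegral.integral_mul_const, intervalIntegral.integral_sub (by simp) (by simp),
      intervalIntegral.integral_const_mul,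
      intervalIntegral.integral_comp_sub_right (fun x => x^2)]
    simp only [integral_id, integral_const, smul_eq_mul, integral_pow]
    push_cast
    ring
  rw [← e]
  apply integral_mono_on hab.le
  · exact hF.continuousOn_mul (by fun_prop)
  · apply Continuous.intervalIntegrable; fun_prop
  · intro s hs
    have hmid : (a+b)/2 ∈ Set.Icc a b := ⟨by linarith, by linarith⟩
    rcases lt_trichotomy s ((a+b)/2) with h | h | h
    · have := hS s hs _ hmid h
      nlinarith
    · rw [h]; simp
    · have := hS _ hmid s hs h
      nlinarith

open intervalIntegral in
theorem hp_chord (F : ℝ → ℝ) (a b : ℝ) (hab : a < b) (hc : ContinuousOn F (Set.Icc a b))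
    (hv : ConvexOn ℝ (Set.Icc a b) F) :
    ∫ s in a..b, F s ≤ (b-a) * (F a + F b) / 2 := by
  have hF : IntervalIntegrable F MeasureTheory.volume a b := by
    apply ContinuousOn.intervalIntegrable; rwa [Set.uIcc_of_le hab.le]
  have hne : b - a ≠ 0 := by linarith
  have e : ∫ s in a..b, (F a + (s - a) * ((F b - F a)/(b-a))) = (b-a) * (F a + F b) / 2 := by
    rw [intervalIntegral.integral_add (by simp)
      (by apply Continuous.intervalIntegrable; fun_prop),
      intervalIntegral.integral_mul_const, intervalIntegral.integral_sub (by simp) (by simp)]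
    simp only [integral_id, integral_const, smul_eq_mul]
    field_simp
    ring
  rw [← e]
  apply integral_mono_on hab.le hF
  · apply Continuous.intervalIntegrable; fun_prop
  · intro s hs
    have hpos : 0 < b - a := by linarith
    have h := hv.2 (Set.left_mem_Icc.2 hab.le) (Set.right_mem_Icc.2 hab.le)
      (div_nonneg (by linarith [hs.2]) hpos.le : 0 ≤ (b-s)/(b-a))
      (div_nonneg (by linarith [hs.1]) hpos.le : 0 ≤ (s-a)/(b-a)) (by field_simp; ring)
    simp only [smul_eq_mul] at h
    have e1 : (b-s)/(b-a) * a + (s-a)/(b-a) * b = s := by field_simp; ring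
    have e2 : (b-s)/(b-a) * F a + (s-a)/(b-a) * F b = F a + (s - a) * ((F b - F a)/(b-a)) := by
      field_simp; ring
    rw [e1, e2] at h
    exact h

open intervalIntegral in
/-- upper bound of `b` by the right-end value -/
theorem hp_b_le' (F : ℝ → ℝ) (a b P : ℝ) (hab : a < b) (hc : ContinuousOn F (Set.Icc a b))
    (h0 : ∀ x ∈ Set.Icc a b, 0 ≤ F x) (hP : ∀ x ∈ Set.Icc a b, F x ≤ P) :
    ∫ s in a..b, (s - (a+b)/2) * F s ≤ (b-a)^2 * P / 4 := by
  have hF : IntervalIntegrable F MeasureTheory.volume a b := by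
    apply ContinuousOn.intervalIntegrable; rwa [Set.uIcc_of_le hab.le]
  have e : ∫ s in a..b, ((s - (a+b)/2) * (P/2) + (b-a)/2 * (P/2)) = (b-a)^2 * P / 4 := by
    rw [intervalIntegral.integral_add
      (by apply Continuous.intervalIntegrable; fun_prop) (by simp),
      intervalIntegral.integral_mul_const, intervalIntegral.integral_sub (by simp) (by simp)]
    simp only [integral_id, integral_const, smul_eq_mul]
    ring
  rw [← e]
  apply integral_mono_on hab.le
  · exact hF.continuousOn_mul (by fun_prop)
  · apply Continuous.intervalIntegrable; fun_prop
  · intro s hs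
    have h1 := h0 s hs
    have h2 := hP s hs
    have h3 := hs.1
    have h4 := hs.2
    nlinarith [mul_nonneg (sub_nonneg.2 h3) (sub_nonneg.2 h2), mul_nonneg (sub_nonneg.2 h4) h1]

open intervalIntegral in
theorem hp_b_le_a (F : ℝ → ℝ) (a b : ℝ) (hab : a < b) (hc : ContinuousOn F (Set.Icc a b))
    (h0 : ∀ x ∈ Set.Icc a b, 0 ≤ F x) :
    ∫ s in a..b, (s - (a+b)/2) * F s ≤ (b-a)/2 * ∫ s in a..b, F s := by
  have hF : IntervalIntegrable F MeasureTheory.volume a b := by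
    apply ContinuousOn.intervalIntegrable; rwa [Set.uIcc_of_le hab.le]
  rw [← intervalIntegral.integral_const_mul]
  apply integral_mono_on hab.le
  · exact hF.continuousOn_mul (by fun_prop)
  · exact hF.const_mul _
  · intro s hs
    exact mul_le_mul_of_nonneg_right (by linarith [hs.2]) (h0 s hs)

theorem hp_slope (F : ℝ → ℝ) (D : Set ℝ) (hv : ConvexOn ℝ D F) (a b q : ℝ) (hbq : b < q)
    (hD : Set.Icc a q ⊆ D) :
    ∀ x ∈ Set.Icc a b, ∀ y ∈ Set.Icc a b, x < y →
      F y - F x ≤ (F q - F b) / (q - b) * (y - x) := by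
  intro x hx y hy hxy
  have hqD : q ∈ D := hD ⟨by linarith [hx.1, hx.2], le_rfl⟩
  have hxD : x ∈ D := hD ⟨hx.1, by linarith [hx.2]⟩
  have hyD : y ∈ D := hD ⟨hy.1, by linarith [hy.2]⟩
  have key : (F y - F x) / (y - x) ≤ (F q - F b) / (q - b) := by
    rcases eq_or_lt_of_le hy.2 with h | h
    · rw [h] at hxy ⊢
      exact hv.slope_mono_adjacent hxD hqD hxy hbq
    · have hbD : b ∈ D := hD ⟨by linarith [hy.1], hbq.le⟩
      exact (hv.slope_mono_adjacent hxD hbD hxy h).trans (hv.slope_mono_adjacent hyD hqD h hbq)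
  rwa [div_le_iff₀ (by linarith)] at key

theorem hp_convex (w α G : ℝ) (hα : 0 < α) (hG : 0 < G) :
    ConvexOn ℝ (Set.Iio w) (fun s => (w - s) ^ (-α) / G) := by
  have h1 : ConvexOn ℝ (Set.Ioi 0) (fun x : ℝ => -α * Real.log x) := by
    have := (strictConcaveOn_log_Ioi.concaveOn.smul hα.le).neg
    apply this.congr
    intro x hx
    simp
  have h2 : ConvexOn ℝ (Set.Ioi 0) (fun x : ℝ => Real.exp (-α * Real.log x)) :=
    ConvexOn.comp (g := Real.exp) (f := fun x : ℝ => -α * Real.log x) (convexOn_exp.subset (Set.subset_univ _)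
      ((isPreconnected_Ioi.image _ (by
        apply ContinuousOn.mul continuousOn_const
        exact Real.continuousOn_log.mono (fun x hx => ne_of_gt hx))).ordConnected.convex)) h1
      (Real.exp_monotone.monotoneOn _)
  have h3 : ConvexOn ℝ (Set.Ioi 0) (fun x : ℝ => x ^ (-α)) := by
    apply h2.congr
    intro x hx
    simp only
    rw [Real.rpow_def_of_pos hx, mul_comm]
  refine ⟨convex_Iio w, fun x hx y hy a b ha hb hab => ?_⟩
  have h := h3.2 (x := w - x) (by simpa using hx) (y := w - y) (by simpa using hy) ha hb hab
  simp only [smul_eq_mul] at h ⊢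
  have e : a * (w - x) + b * (w - y) = w - (a*x + b*y) := by
    linear_combination w * hab
  rw [e] at h
  rw [mul_div_assoc', mul_div_assoc', ← add_div]
  gcongr

theorem hp_mono (w α G : ℝ) (hα : 0 < α) (hG : 0 < G) :
    MonotoneOn (fun s => (w - s) ^ (-α) / G) (Set.Iio w) := by
  intro x hx y hy hxy
  simp only
  have : (w - x) ^ (-α) ≤ (w - y) ^ (-α) :=
    Real.rpow_le_rpow_of_nonpos (by simpa using hy) (by linarith) (by linarith)
  gcongr

theorem hp_cont (w α G : ℝ) :
    ContinuousOn (fun s => (w - s) ^ (-α) / G) (Set.Iio w) := by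
  apply ContinuousOn.div_const
  apply ContinuousOn.rpow_const (by fun_prop)
  intro x hx
  left
  have : x < w := hx
  linarith

theorem hp_int (w α G a : ℝ) (hα1 : α < 1) (h : a < w) :
    ∫ s in a..w, (w - s) ^ (-α) / G = (w - a) * ((w - a) ^ (-α) / G) / (1 - α) := by
  rw [intervalIntegral.integral_div,
    intervalIntegral.integral_comp_sub_left (fun x => x ^ (-α)) w,
    integral_rpow (Or.inl (by linarith)), sub_self, Real.zero_rpow (by linarith),
    Real.rpow_add_one (by linarith)]
  have : -α + 1 = 1 - α := by ring
  rw [this]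
  ring

/-- `P := F(t_{n-1})` versus `Q := τ^{-α}/Γ`. -/
theorem hp_PQ (α τ G : ℝ) (hα0 : 0 < α) (hα1 : α < 1) (hτ : 0 < τ) (hG : 0 < G) :
    τ ^ (-α) / G ≤ ((1 - α/2) * τ) ^ (-α) / G ∧
    (1 - α/2) * (((1 - α/2) * τ) ^ (-α) / G) ≤ τ ^ (-α) / G := by
  have hσ : 0 < 1 - α/2 := by linarith
  have h1 : 1 ≤ (1 - α/2) ^ (-α) :=
    Real.one_le_rpow_of_pos_of_le_one_of_nonpos hσ (by linarith) (by linarith)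
  have h2 : (1 - α/2) * (1 - α/2) ^ (-α) ≤ 1 := by
    rw [mul_comm, ← Real.rpow_add_one hσ.ne']
    exact Real.rpow_le_one hσ.le (by linarith) (by linarith)
  have hT : 0 < τ ^ (-α) := Real.rpow_pos_of_pos hτ _
  rw [Real.mul_rpow hσ.le hτ.le]
  constructor
  · gcongr
    nlinarith
  · rw [mul_div_assoc']
    gcongr
    nlinarith


theorem hp_upper (F : ℝ → ℝ) (w p0 p1 p2 : ℝ) (h01 : p0 < p1) (h12 : p1 < p2) (h2w : p2 < w)
    (hv : ConvexOn ℝ (Set.Iio w) F) (hm : MonotoneOn F (Set.Iio w))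
    (hc : ContinuousOn F (Set.Iio w)) (hr : (p1 - p0) / (p2 - p1) ≤ 7/4) :
    1 / (p2 - p1) * (∫ s in p1..p2, F s) + (p1 - p0) / (p2 - p1) *
      (2 / ((p1 - p0) * ((p1 - p0) + (p2 - p1))) * ∫ s in p0..p1, (s - (p0 + p1)/2) * F s)
      ≤ F p2 := by
  have sub : ∀ a b : ℝ, b < w → Set.Icc a b ⊆ Set.Iio w := fun a b hb x hx => lt_of_le_of_lt hx.2 hb
  have hI := hp_chord F p1 p2 h12 (hc.mono (sub _ _ h2w)) (hv.subset (sub _ _ h2w) (convex_Icc _ _))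
  have hB := hp_b_le F p0 p1 _ h01 (hc.mono (sub _ _ (h12.trans h2w)))
    (hp_slope F _ hv p0 p1 p2 h12 (sub _ _ h2w))
  have hF : F p1 ≤ F p2 := hm (h12.trans h2w) h2w h12.le
  generalize (∫ s in p1..p2, F s) = I at *
  generalize (∫ s in p0..p1, (s - (p0 + p1)/2) * F s) = B at *
  obtain ⟨y, hy⟩ : ∃ y, y = p2 - p1 := ⟨_, rfl⟩
  obtain ⟨x, hx⟩ : ∃ x, x = p1 - p0 := ⟨_, rfl⟩
  rw [← hy] at hr hI hB ⊢
  rw [← hx] at hr hB ⊢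
  have hy0 : 0 < y := by linarith
  have hx0 : 0 < x := by linarith
  rw [div_le_iff₀ hy0] at hr
  have e1 : 1 / y * I ≤ (F p1 + F p2) / 2 := by
    rw [one_div_mul_eq_div, div_le_iff₀ hy0]; linarith
  have e2 : x / y * (2 / (x * (x + y)) * B) ≤ (F p2 - F p1) / 2 := by
    have : x / y * (2 / (x * (x + y)) * B) = 2 / (y * (x+y)) * B := by field_simp
    rw [this]
    calc 2 / (y * (x+y)) * B ≤ 2 / (y * (x+y)) * ((F p2 - F p1) / y * x^3 / 12) := by gcongr
      _ = (F p2 - F p1) / 2 * (x^3 / (3 * y^2 * (x+y))) := by field_simp; ring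
      _ ≤ (F p2 - F p1) / 2 * 1 := by
        apply mul_le_mul_of_nonneg_left _ (by linarith)
        rw [div_le_one (by positivity)]
        have : x * x ≤ (7/4*y) * (7/4*y) := by gcongr
        nlinarith [mul_pos hx0 (mul_pos hy0 hy0), mul_pos hx0 hy0, pow_pos hy0 3, mul_le_mul_of_nonneg_left this hx0.le, mul_le_mul_of_nonneg_left hr (mul_pos hy0 hy0).le]
      _ = _ := by ring
  linarith

theorem hp_upper1 (F : ℝ → ℝ) (w p1 p2 : ℝ) (h12 : p1 < p2) (h2w : p2 < w)
    (hv : ConvexOn ℝ (Set.Iio w) F) (hm : MonotoneOn F (Set.Iio w))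
    (hc : ContinuousOn F (Set.Iio w)) :
    1 / (p2 - p1) * (∫ s in p1..p2, F s) ≤ F p2 := by
  have sub : ∀ a b : ℝ, b < w → Set.Icc a b ⊆ Set.Iio w := fun a b hb x hx => lt_of_le_of_lt hx.2 hb
  have hI := hp_chord F p1 p2 h12 (hc.mono (sub _ _ h2w)) (hv.subset (sub _ _ h2w) (convex_Icc _ _))
  have hF : F p1 ≤ F p2 := hm (h12.trans h2w) h2w h12.le
  rw [one_div_mul_eq_div, div_le_iff₀ (by linarith)]
  nlinarith

/-- lower bound for `a - b` -/
theorem hp_lower (F H : ℝ → ℝ) (w p1 p2 p3 : ℝ) (h12 : p1 < p2) (h23 : p2 < p3) (h2w : p2 < w)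
    (hc : ContinuousOn F (Set.Iio w)) (hcH : ContinuousOn H (Set.Icc p1 p2))
    (h0 : ∀ s, s < w → 0 ≤ F s) (hH : ∀ s, s < w → H s ≤ F s)
    (hr : (p2 - p1) / (p3 - p2) ≤ 7/4) :
    4 / (11 * (p2 - p1)) * (∫ s in p1..p2, H s) ≤ 1 / (p2 - p1) * (∫ s in p1..p2, F s) -
      2 / ((p2 - p1) * ((p2 - p1) + (p3 - p2))) * ∫ s in p1..p2, (s - (p1 + p2)/2) * F s := by
  have sub : Set.Icc p1 p2 ⊆ Set.Iio w := fun x hx => lt_of_le_of_lt hx.2 h2w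
  have hB := hp_b_le_a F p1 p2 h12 (hc.mono sub) (fun x hx => h0 x (sub hx))
  have hHF : ∫ s in p1..p2, H s ≤ ∫ s in p1..p2, F s := by
    apply intervalIntegral.integral_mono_on h12.le
    · apply ContinuousOn.intervalIntegrable; rwa [Set.uIcc_of_le h12.le]
    · apply ContinuousOn.intervalIntegrable; rw [Set.uIcc_of_le h12.le]; exact hc.mono sub
    · intro s hs; exact hH s (sub hs)
  have hI0 : 0 ≤ ∫ s in p1..p2, F s :=
    intervalIntegral.integral_nonneg h12.le (fun x hx => h0 x (sub hx))
  generalize (∫ s in p1..p2, F s) = I at *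
  generalize (∫ s in p1..p2, H s) = J at *
  generalize (∫ s in p1..p2, (s - (p1 + p2)/2) * F s) = B at *
  obtain ⟨y, hy⟩ : ∃ y, y = p3 - p2 := ⟨_, rfl⟩
  obtain ⟨x, hx⟩ : ∃ x, x = p2 - p1 := ⟨_, rfl⟩
  rw [← hy] at hr ⊢
  rw [← hx] at hr hB ⊢
  have hy0 : 0 < y := by linarith
  have hx0 : 0 < x := by linarith
  rw [div_le_iff₀ hy0] at hr
  have e1 : 2 / (x * (x + y)) * B ≤ 7 / (11 * x) * I := by
    calc 2 / (x * (x + y)) * B ≤ 2 / (x * (x + y)) * (x / 2 * I) := by gcongr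
      _ = 1 / (x + y) * I := by field_simp
      _ ≤ 7 / (11 * x) * I := by
        apply mul_le_mul_of_nonneg_right _ hI0
        rw [div_le_div_iff₀ (by positivity) (by positivity)]
        linarith
  have e2 : 4 / (11 * x) * J ≤ 4 / (11 * x) * I := by gcongr
  have e3 : 1 / x * I = 4 / (11 * x) * I + 7 / (11 * x) * I := by field_simp; norm_num
  linarith

/-- upper bound for `ρ b` in terms of the right-end value -/
theorem hp_rhob (F : ℝ → ℝ) (w p0 p1 p2 : ℝ) (h01 : p0 < p1) (h12 : p1 < p2) (h1w : p1 < w)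
    (hm : MonotoneOn F (Set.Iio w)) (h0 : ∀ s, s < w → 0 ≤ F s)
    (hc : ContinuousOn F (Set.Iio w)) (hr : (p1 - p0) / (p2 - p1) ≤ 7/4) :
    (p1 - p0) / (p2 - p1) *
      (2 / ((p1 - p0) * ((p1 - p0) + (p2 - p1))) * ∫ s in p0..p1, (s - (p0 + p1)/2) * F s)
      ≤ 49/88 * F p1 := by
  have sub : Set.Icc p0 p1 ⊆ Set.Iio w := fun x hx => lt_of_le_of_lt hx.2 h1w
  have hB := hp_b_le' F p0 p1 (F p1) h01 (hc.mono sub) (fun x hx => h0 x (sub hx))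
    (fun x hx => hm (sub hx) h1w hx.2)
  have hF := h0 p1 h1w
  generalize (∫ s in p0..p1, (s - (p0 + p1)/2) * F s) = B at *
  obtain ⟨y, hy⟩ : ∃ y, y = p2 - p1 := ⟨_, rfl⟩
  obtain ⟨x, hx⟩ : ∃ x, x = p1 - p0 := ⟨_, rfl⟩
  rw [← hy] at hr ⊢
  rw [← hx] at hr hB ⊢
  have hy0 : 0 < y := by linarith
  have hx0 : 0 < x := by linarith
  rw [div_le_iff₀ hy0] at hr
  have : x / y * (2 / (x * (x + y)) * B) = 2 / (y * (x+y)) * B := by field_simp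
  rw [this]
  calc 2 / (y * (x+y)) * B ≤ 2 / (y * (x+y)) * (x^2 * F p1 / 4) := by gcongr
      _ = x^2 / (2 * y * (x+y)) * F p1 := by field_simp; ring
      _ ≤ 49/88 * F p1 := by
        apply mul_le_mul_of_nonneg_right _ hF
        rw [div_le_iff₀ (by positivity)]
        nlinarith [mul_nonneg (sub_nonneg.2 hr) hx0.le, mul_nonneg (sub_nonneg.2 hr) hy0.le]

/-- Two-sided bounds for the nonuniform Alikhanov kernels (Theorem 2.2 (III)). -/
theorem stmt_16 (N : ℕ) (hN : 1 ≤ N) (α T : ℝ) (hα0 : 0 < α) (hα1 : α < 1)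
    (t : ℕ → ℝ) (ht0 : t 0 = 0) (htN : t N = T)
    (htmono : ∀ k : ℕ, 1 ≤ k → k ≤ N → t (k-1) < t k)
    (hρ : ∀ k : ℕ, 1 ≤ k → k ≤ N - 1 → rhok t k ≤ 7/4)
    (n k : ℕ) (hk1 : 1 ≤ k) (hkn : k ≤ n) (hnN : n ≤ N) :
    AK α t n k ≤ AK α t n n ∧
    (k < n → AK α t n k < AK α t n n) ∧
    AK α t n n ≤ (24 / (11 * (t n - t (n-1)))) *
        ∫ s in (t (n-1))..(t n), (t n - s) ^ (-α) / Real.Gamma (1-α) ∧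
    (4 / (11 * (t k - t (k-1)))) *
        ∫ s in (t (k-1))..(t k), (t n - s) ^ (-α) / Real.Gamma (1-α) ≤ AK α t n k := by
  have hG : 0 < Real.Gamma (1-α) := Real.Gamma_pos_of_pos (by linarith)
  have hn1 : 1 ≤ n := hk1.trans hkn
  have hτ : 0 < t n - t (n-1) := by linarith [htmono n hn1 hnN]
  obtain ⟨w, hw⟩ : ∃ w, w = tw (α/2) t n := ⟨_, rfl⟩
  have hw1 : w - t (n-1) = (1 - α/2) * (t n - t (n-1)) := by rw [hw, tw]; ring
  have hw2 : w ≤ t n := by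
    have : w = t n - α/2 * (t n - t (n-1)) := by rw [hw, tw]; ring
    rw [this]; nlinarith
  have hw3 : t (n-1) < w := by
    have : 0 < (1 - α/2) * (t n - t (n-1)) := mul_pos (by linarith) hτ
    linarith
  obtain ⟨F, hF⟩ : ∃ F : ℝ → ℝ, F = fun s => (w - s) ^ (-α) / Real.Gamma (1-α) := ⟨_, rfl⟩
  have hv : ConvexOn ℝ (Set.Iio w) F := by rw [hF]; exact hp_convex w α _ hα0 hG
  have hm : MonotoneOn F (Set.Iio w) := by rw [hF]; exact hp_mono w α _ hα0 hG
  have hc : ContinuousOn F (Set.Iio w) := by rw [hF]; exact hp_cont w α _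
  have h0 : ∀ s, s < w → 0 ≤ F s := by
    intro s hs; rw [hF]
    exact div_nonneg (Real.rpow_nonneg (by linarith) _) hG.le
  have hmesh : ∀ j, j + 1 ≤ N → t j < t (j+1) := fun j hj => htmono (j+1) (by omega) hj
  have hmono : ∀ i j, i ≤ j → j ≤ N → t i ≤ t j := by
    intro i j hij
    induction j, hij using Nat.le_induction with
    | base => intro _; exact le_rfl
    | succ j hj ih => intro hjN; exact (ih (by omega)).trans (hmesh j hjN).le
  have hlt : ∀ j, j + 1 ≤ n → t j < w := fun j hj =>
    lt_of_le_of_lt (hmono j (n-1) (by omega) (by omega)) hw3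
  -- the coefficients
  have ha0 : aco α t n n = (1 - α/2) * F (t (n-1)) / (1 - α) := by
    rw [aco, if_pos rfl, ← hw, hp_int w α _ _ hα1 hw3, hF]
    simp only
    rw [hw1]
    have : (1 - α) ≠ 0 := by linarith
    field_simp
  have ha : ∀ j, j + 1 < n → aco α t n (j+1) = 1 / (t (j+1) - t j) * ∫ s in (t j)..(t (j+1)), F s := by
    intro j hj
    rw [aco, if_neg (by omega), ← hw, hF]; rfl
  have hb : ∀ j, bco α t n (j+1) = 2 / ((t (j+1) - t j) * ((t (j+1) - t j) + (t (j+2) - t (j+1)))) *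
      ∫ s in (t j)..(t (j+1)), (s - (t j + t (j+1))/2) * F s := by
    intro j
    rw [bco, ← hw, hF]; rfl
  have hrr : ∀ j, rhok t (j+1) = (t (j+1) - t j) / (t (j+2) - t (j+1)) := fun j => rfl
  have hrle : ∀ j, j + 2 ≤ n → (t (j+1) - t j) / (t (j+2) - t (j+1)) ≤ 7/4 := fun j hj =>
    hρ (j+1) (by omega) (by omega)
  have hb0 : ∀ j, j + 2 ≤ n → 0 ≤ bco α t n (j+1) := by
    intro j hj
    rw [hb]
    have h1 := hmesh j (by omega)
    have h2 := hmesh (j+1) (by omega)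
    have sub : Set.Icc (t j) (t (j+1)) ⊆ Set.Iio w :=
      fun x hx => lt_of_le_of_lt hx.2 (hlt (j+1) (by omega))
    apply mul_nonneg
    · apply div_nonneg (by norm_num)
      apply mul_nonneg (by linarith)
      have : t (j+1) < t (j+2) := h2
      linarith
    · exact hp_b_nonneg F _ _ h1 (hc.mono sub) (hm.mono sub)
  have hrb0 : ∀ j, j + 2 ≤ n → 0 ≤ rhok t (j+1) * bco α t n (j+1) := by
    intro j hj
    apply mul_nonneg _ (hb0 j hj)
    rw [hrr]
    have h1 := hmesh j (by omega)
    have h2 : t (j+1) < t (j+2) := hmesh (j+1) (by omega)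
    exact div_nonneg (by linarith) (by linarith)
  have hP0 : 0 < F (t (n-1)) := by
    rw [hF]; exact div_pos (Real.rpow_pos_of_pos (by linarith) _) hG
  -- bounds for the leading kernel
  have hA0 : aco α t n n ≤ AK α t n n ∧ AK α t n n ≤ aco α t n n + 49/88 * F (t (n-1)) := by
    by_cases hn : n ≤ 1
    · rw [AK, if_pos hn]
      exact ⟨le_rfl, by linarith⟩
    · obtain ⟨m, rfl⟩ : ∃ m, n = m + 2 := ⟨n - 2, by omega⟩
      rw [AK, if_neg hn, if_pos rfl]
      have e : m + 2 - 1 = m + 1 := rfl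
      rw [e]
      have h1 := hrb0 m le_rfl
      have h2 : rhok t (m+1) * bco α t (m+2) (m+1) ≤ 49/88 * F (t (m+1)) := by
        rw [hrr, hb]
        exact hp_rhob F w _ _ _ (hmesh m (by omega)) (hmesh (m+1) (by omega)) (hlt (m+1) le_rfl)
          hm h0 hc (hrle m le_rfl)
      constructor <;> linarith
  -- strict comparison
  have hstrict : k < n → AK α t n k < AK α t n n := by
    intro hkn'
    have h1 : F (t (n-1)) < aco α t n n := by
      rw [ha0, lt_div_iff₀ (by linarith)]
      nlinarith
    have h2 : F (t k) ≤ F (t (n-1)) :=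
      hm (hlt k hkn') hw3 (hmono k (n-1) (by omega) (by omega))
    have h3 : AK α t n k ≤ F (t k) := by
      rw [AK, if_neg (by omega), if_neg (by omega)]
      by_cases hk : k = 1
      · subst hk
        rw [if_pos rfl]
        have h4 := hb0 0 (by omega)
        have h5 := hp_upper1 F w (t 0) (t 1) (hmesh 0 (by omega)) (hlt 1 (by omega)) hv hm hc
        have h6 := ha 0 (by omega)
        simp only [zero_add] at h4 h6
        rw [h6]; linarith
      · rw [if_neg hk]
        obtain ⟨j, rfl⟩ : ∃ j, k = j + 2 := ⟨k - 2, by omega⟩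
        have e : j + 2 - 1 = j + 1 := rfl
        rw [e]
        have h4 := hb0 (j+1) (by omega)
        have h5 := hp_upper F w (t j) (t (j+1)) (t (j+2)) (hmesh j (by omega))
          (hmesh (j+1) (by omega)) (hlt (j+2) (by omega)) hv hm hc (hrle j (by omega))
        rw [ha (j+1) (by omega), hb j, hrr]
        have h6 : bco α t n (j+1+1) = bco α t n (j+2) := rfl
        rw [h6] at h4
        have h7 : t (j+1+1) = t (j+2) := rfl
        rw [h7]
        linarith
    linarith [hA0.1]
  have hPQ := hp_PQ α (t n - t (n-1)) (Real.Gamma (1-α)) hα0 hα1 hτ hG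
  have hFn : F (t (n-1)) = ((1 - α/2) * (t n - t (n-1))) ^ (-α) / Real.Gamma (1-α) := by
    rw [hF]; simp only; rw [hw1]
  rw [← hFn] at hPQ
  have hIn := hp_int (t n) α (Real.Gamma (1-α)) (t (n-1)) hα1 (by linarith)
  obtain ⟨Q, hQ⟩ : ∃ Q, Q = (t n - t (n-1)) ^ (-α) / Real.Gamma (1-α) := ⟨_, rfl⟩
  rw [← hQ] at hPQ hIn
  have h1α : 0 < 1 - α := by linarith
  refine ⟨?_, hstrict, ?_, ?_⟩
  · rcases eq_or_lt_of_le hkn with h | h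
    · rw [h]
    · exact (hstrict h).le
  · refine hA0.2.trans ?_
    rw [hIn, ha0]
    have e : 24 / (11 * (t n - t (n-1))) * ((t n - t (n-1)) * Q / (1 - α)) = 24/11 * Q / (1-α) := by
      field_simp
    rw [e, le_div_iff₀ h1α, add_mul, div_mul_cancel₀ _ h1α.ne']
    nlinarith [mul_pos hP0 hα0, mul_pos hP0 h1α]
  · rcases eq_or_lt_of_le hkn with h | h
    · subst h
      refine le_trans ?_ hA0.1
      rw [hIn, ha0]
      have e : 4 / (11 * (t k - t (k-1))) * ((t k - t (k-1)) * Q / (1 - α)) = 4/11 * Q / (1-α) := by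
        field_simp
      rw [e, div_le_div_iff_of_pos_right h1α]
      nlinarith [mul_pos hP0 hα0, mul_pos hP0 h1α]
    · obtain ⟨j, rfl⟩ : ∃ j, k = j + 1 := ⟨k - 1, by omega⟩
      have hl := hp_lower F (fun s => (t n - s) ^ (-α) / Real.Gamma (1-α)) w (t j) (t (j+1))
        (t (j+2)) (hmesh j (by omega)) (hmesh (j+1) (by omega)) (hlt (j+1) (by omega)) hc
        ((hp_cont (t n) α _).mono (fun x hx => lt_of_le_of_lt hx.2
          (lt_of_lt_of_le (hlt (j+1) (by omega)) hw2))) h0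
        (by
          intro s hs
          rw [hF]
          simp only
          have : (t n - s) ^ (-α) ≤ (w - s) ^ (-α) :=
            Real.rpow_le_rpow_of_nonpos (by linarith) (by linarith) (by linarith)
          gcongr)
        (hrle j (by omega))
      rw [← ha j h, ← hb j] at hl
      refine le_trans hl ?_
      rw [AK, if_neg (by omega), if_neg (by omega)]
      by_cases hk : j + 1 = 1
      · rw [if_pos hk]
        obtain rfl : j = 0 := by omega
        exact le_rfl
      · rw [if_neg hk]
        obtain ⟨i, rfl⟩ : ∃ i, j = i + 1 := ⟨j - 1, by omega⟩
        have := hrb0 i (by omega)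
        have e : i + 1 + 1 - 1 = i + 1 := rfl
        rw [e]
        linarith
end
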